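/- arXiv:1707.09276 — 2 statements merged into one kernel-verified Lean document; each statement's English description precedes it below -/
import Mathlib

section
/- For every M > 0 and every integer k ≥ 1 there is a finite positive constant C (depending only on M and k) such that for all distinct points x_1, …, x_k ∈ [−M, M], (1/C) ∏_{1 ≤ i < j ≤ k} |x_i − x_j| ≤ ρ_k(x_1, …, x_k) ≤ C ∏_{1 ≤ i < j ≤ k} |x_i − x_j|, where ρ_k is the k-point correlation function of the real zeros of the Weyl series P_∞. -/
open MeasureTheory ProbabilityTheory Real Filter Topology
open scoped BigOperators Classical

noncomputable section

/-- The Weyl polynomial `P_n(x) = ∑_{k=0}^n ξ_k x^k / √(k!)` as a `Polynomial ℝ`. -/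
def weylPoly {Ω : Type*} (ξ : ℕ → Ω → ℝ) (n : ℕ) (ω : Ω) : Polynomial ℝ :=
  ∑ k ∈ Finset.range (n + 1),
    Polynomial.C (ξ k ω / Real.sqrt (Nat.factorial k)) * Polynomial.X ^ k

/-- The Weyl series `P_∞(x) = ∑_{k=0}^∞ ξ_k x^k / √(k!)`. -/
def weylSeries {Ω : Type*} (ξ : ℕ → Ω → ℝ) (ω : Ω) (x : ℝ) : ℝ :=
  ∑' k : ℕ, ξ k ω * x ^ k / Real.sqrt (Nat.factorial k)

/-- Covariance of the 2-jet of the Weyl series at points `s`, `t`: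
`weylCov s t a b = E[P_∞^{(a)}(s) P_∞^{(b)}(t)]` for `a b : Fin 2`,
computed from the covariance kernel `E[P_∞(s)P_∞(t)] = e^{st}`. -/
def weylCov (s t : ℝ) (a b : Fin 2) : ℝ :=
  (if a = 0 then (if b = 0 then 1 else s) else (if b = 0 then t else 1 + s * t)) *
    Real.exp (s * t)

/-- The covariance matrix `Γ` of `(P_∞(x_1), P_∞'(x_1), …, P_∞(x_k), P_∞'(x_k))`. -/
def weylGamma {k : ℕ} (x : Fin k → ℝ) :
    Matrix (Fin k × Fin 2) (Fin k × Fin 2) ℝ :=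
  fun p q => weylCov (x p.1) (x q.1) p.2 q.2

/-- The vector `η = (0, η_1, 0, η_2, …, 0, η_k) ∈ ℝ^{2k}`. -/
def weylEta {k : ℕ} (η : Fin k → ℝ) : Fin k × Fin 2 → ℝ :=
  fun p => if p.2 = 1 then η p.1 else 0

/-- The `k`-point correlation function of the real zeros of the Weyl series, given by the
Kac–Rice formula `ρ_k(x) = (2π)^{-k} |det Γ|^{-1/2} ∫_{ℝ^k} |η_1⋯η_k| exp(-½⟨Γ⁻¹η, η⟩) dη`. -/
def weylRho (k : ℕ) (x : Fin k → ℝ) : ℝ :=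
  ((2 * Real.pi) ^ k)⁻¹ * (Real.sqrt |(weylGamma x).det|)⁻¹ *
    ∫ η : Fin k → ℝ,
      (∏ i, |η i|) *
        Real.exp (-(1 / 2) *
          ∑ p, (weylGamma x)⁻¹.mulVec (weylEta η) p * weylEta η p)

/-- The constant `K = 1/π + ∫_ℝ (ρ₂(0,t) − 1/π²) dt`. -/
def weylK : ℝ :=
  1 / Real.pi + ∫ t : ℝ, (weylRho 2 ![0, t] - 1 / Real.pi ^ 2)

/-- The interval `I_n = [−√n + n^{1/6} log n, √n − n^{1/6} log n]`. -/
def weylIntvl (n : ℕ) : Set ℝ :=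
  Set.Icc (-Real.sqrt n + (n : ℝ) ^ ((1 : ℝ) / 6) * Real.log n)
    (Real.sqrt n - (n : ℝ) ^ ((1 : ℝ) / 6) * Real.log n)

section HermiteInterpolation

open Polynomial Matrix

/-- The monic polynomial `∏ i, (X - x i)` with roots at the nodes. -/
def nodePoly {k : ℕ} (x : Fin k → ℝ) : ℝ[X] := ∏ i, (X - C (x i))

lemma nodePoly_monic {k : ℕ} (x : Fin k → ℝ) : (nodePoly x).Monic :=
  monic_prod_of_monic _ _ fun i _ => monic_X_sub_C (x i)

lemma nodePoly_natDegree {k : ℕ} (x : Fin k → ℝ) : (nodePoly x).natDegree = k := by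
  simp [nodePoly, natDegree_prod_of_monic _ _ fun i _ => monic_X_sub_C (x i)]

lemma nodePoly_degree {k : ℕ} (x : Fin k → ℝ) : (nodePoly x).degree = k := by
  rw [degree_eq_natDegree (nodePoly_monic x).ne_zero, nodePoly_natDegree]

lemma eval_nodePoly {k : ℕ} (x : Fin k → ℝ) (i : Fin k) : (nodePoly x).eval (x i) = 0 := by
  rw [nodePoly, eval_prod]
  exact Finset.prod_eq_zero (Finset.mem_univ i) (by simp)

lemma eval_derivative_nodePoly {k : ℕ} (x : Fin k → ℝ) (i : Fin k) :
    (derivative (nodePoly x)).eval (x i) = ∏ j ∈ Finset.univ.erase i, (x i - x j) := by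
  have h : nodePoly x = (X - C (x i)) * ∏ j ∈ Finset.univ.erase i, (X - C (x j)) :=
    (Finset.mul_prod_erase _ _ (Finset.mem_univ i)).symm
  rw [h, derivative_mul]
  simp [eval_prod]

lemma abs_coeff_nodePoly_le {k : ℕ} {M : ℝ} (hM : 0 ≤ M) (x : Fin k → ℝ)
    (hx : ∀ i, |x i| ≤ M) (n : ℕ) : |(nodePoly x).coeff n| ≤ (1 + M) ^ k := by
  have key : ∀ (s : Finset (Fin k)) (n : ℕ),
      |(∏ i ∈ s, (X - C (x i))).coeff n| ≤ (1 + M) ^ s.card := by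
    intro s
    induction s using Finset.induction_on with
    | empty =>
      intro n
      rw [Finset.prod_empty, coeff_one]
      split_ifs <;> simp
    | insert a s ha ih =>
      intro n
      rw [Finset.prod_insert ha, Finset.card_insert_of_notMem ha, sub_mul, coeff_sub,
        coeff_C_mul, pow_succ]
      have h1 : |(X * ∏ i ∈ s, (X - C (x i))).coeff n| ≤ (1 + M) ^ s.card := by
        cases n with
        | zero => simp only [mul_coeff_zero, coeff_X_zero, zero_mul, abs_zero]; positivity
        | succ m => rw [coeff_X_mul]; exact ih m
      have h2 : |x a * (∏ i ∈ s, (X - C (x i))).coeff n| ≤ M * (1 + M) ^ s.card := by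
        rw [abs_mul]
        exact mul_le_mul (hx a) (ih n) (abs_nonneg _) hM
      calc _ ≤ _ := abs_sub _ _
        _ ≤ (1 + M) ^ s.card + M * (1 + M) ^ s.card := add_le_add h1 h2
        _ = _ := by ring
  simpa [nodePoly] using key Finset.univ n

/-- The basis `X ^ j, nodePoly x * X ^ j` (`j < k`) of the polynomials of degree less than `2k`. -/
def hermiteBasis {k : ℕ} (x : Fin k → ℝ) (q : Fin k × Fin 2) : ℝ[X] :=
  if q.2 = 0 then X ^ (q.1 : ℕ) else nodePoly x * X ^ (q.1 : ℕ)

lemma natDegree_hermiteBasis_lt {k : ℕ} (x : Fin k → ℝ) (q : Fin k × Fin 2) :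
    (hermiteBasis x q).natDegree < 2 * k := by
  have := q.1.isLt
  unfold hermiteBasis
  split_ifs
  · rw [natDegree_X_pow]; omega
  · rw [(nodePoly_monic x).natDegree_mul (monic_X_pow _), nodePoly_natDegree, natDegree_X_pow]
    omega

lemma abs_coeff_hermiteBasis_le {k : ℕ} {M : ℝ} (hM : 0 ≤ M) (x : Fin k → ℝ)
    (hx : ∀ i, |x i| ≤ M) (q : Fin k × Fin 2) (n : ℕ) :
    |(hermiteBasis x q).coeff n| ≤ (1 + M) ^ k := by
  have h1 : (1 : ℝ) ≤ (1 + M) ^ k := one_le_pow₀ (by linarith)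
  unfold hermiteBasis
  split_ifs
  · rw [coeff_X_pow]
    split_ifs
    · simpa using h1
    · simp only [abs_zero]; linarith
  · rw [coeff_mul_X_pow']
    split_ifs
    · exact abs_coeff_nodePoly_le hM x hx _
    · simp only [abs_zero]; linarith

lemma add_divModByMonic {q : ℝ[X]} (hq : q.Monic) (a b : ℝ[X]) :
    (a + b) /ₘ q = a /ₘ q + b /ₘ q ∧ (a + b) %ₘ q = a %ₘ q + b %ₘ q := by
  refine div_modByMonic_unique _ _ hq ⟨?_, ?_⟩
  · conv_rhs => rw [← modByMonic_add_div a q, ← modByMonic_add_div b q]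
    ring
  · exact (degree_add_le _ _).trans_lt
      (max_lt (degree_modByMonic_lt _ hq) (degree_modByMonic_lt _ hq))

lemma smul_divModByMonic {q : ℝ[X]} (hq : q.Monic) (c : ℝ) (a : ℝ[X]) :
    (c • a) /ₘ q = c • (a /ₘ q) ∧ (c • a) %ₘ q = c • (a %ₘ q) := by
  refine div_modByMonic_unique _ _ hq ⟨?_, ?_⟩
  · conv_rhs => rw [← modByMonic_add_div a q]
    rw [smul_add, mul_smul_comm]
  · exact (degree_smul_le _ _).trans_lt (degree_modByMonic_lt _ hq)

/-- Coordinates in `hermiteBasis x` of the remainder modulo `(nodePoly x) ^ 2`. -/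
def hermiteCoord {k : ℕ} (x : Fin k → ℝ) : ℝ[X] →ₗ[ℝ] (Fin k × Fin 2 → ℝ) where
  toFun p q := if q.2 = 0 then (p %ₘ nodePoly x).coeff q.1
    else ((p /ₘ nodePoly x) %ₘ nodePoly x).coeff q.1
  map_add' a b := by
    ext q
    have h := nodePoly_monic x
    simp only [(add_divModByMonic h _ _).1, (add_divModByMonic h _ _).2, coeff_add, Pi.add_apply]
    split_ifs <;> rfl
  map_smul' c a := by
    ext q
    have h := nodePoly_monic x
    simp only [(smul_divModByMonic h _ _).1, (smul_divModByMonic h _ _).2, coeff_smul,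
      Pi.smul_apply, RingHom.id_apply]
    split_ifs <;> rfl

lemma hermiteCoord_apply {k : ℕ} (x : Fin k → ℝ) (p : ℝ[X]) (q : Fin k × Fin 2) :
    hermiteCoord x p q = if q.2 = 0 then (p %ₘ nodePoly x).coeff q.1
      else ((p /ₘ nodePoly x) %ₘ nodePoly x).coeff q.1 := rfl

lemma hermiteCoord_hermiteBasis {k : ℕ} (x : Fin k → ℝ) (q : Fin k × Fin 2) :
    hermiteCoord x (hermiteBasis x q) = Pi.single q 1 := by
  have h := nodePoly_monic x
  obtain ⟨j, a⟩ := q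
  have hlt : (X ^ (j : ℕ) : ℝ[X]).degree < (nodePoly x).degree := by
    rw [degree_X_pow, nodePoly_degree]
    exact_mod_cast j.isLt
  have hmod : (X ^ (j : ℕ) : ℝ[X]) %ₘ nodePoly x = X ^ (j : ℕ) := (modByMonic_eq_self_iff h).2 hlt
  have hdiv : (X ^ (j : ℕ) : ℝ[X]) /ₘ nodePoly x = 0 := (divByMonic_eq_zero_iff h).2 hlt
  ext ⟨i, b⟩
  rw [hermiteCoord_apply]
  fin_cases a <;> fin_cases b <;>
    simp [hermiteBasis, hmod, hdiv, mul_divByMonic_cancel_left _ h, self_mul_modByMonic h,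
      Pi.single_apply, coeff_X_pow, Fin.ext_iff]

lemma sum_coeff_mul_X_pow {k : ℕ} (p : ℝ[X]) (hp : p.degree < k) :
    ∑ j : Fin k, p.coeff j • (X ^ (j : ℕ) : ℝ[X]) = p := by
  rw [Fin.sum_univ_eq_sum_range (fun j => p.coeff j • (X ^ j : ℝ[X])) k]
  ext n
  simp only [finsetSum_coeff, coeff_smul, coeff_X_pow, smul_eq_mul, mul_ite, mul_one, mul_zero,
    Finset.sum_ite_eq, Finset.mem_range]
  split_ifs with hn
  · rfl
  · exact (coeff_eq_zero_of_degree_lt (hp.trans_le (by exact_mod_cast not_lt.1 hn))).symm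

lemma sum_hermiteCoord_smul {k : ℕ} (x : Fin k → ℝ) (p : ℝ[X]) :
    ∑ q, hermiteCoord x p q • hermiteBasis x q =
      p %ₘ nodePoly x + nodePoly x * ((p /ₘ nodePoly x) %ₘ nodePoly x) := by
  have h := nodePoly_monic x
  have hd : ∀ p : ℝ[X], (p %ₘ nodePoly x).degree < k := fun p =>
    nodePoly_degree x ▸ degree_modByMonic_lt p h
  rw [Fintype.sum_prod_type]
  simp only [Fin.sum_univ_two, hermiteCoord_apply, hermiteBasis, if_true, one_ne_zero, if_false]
  rw [Finset.sum_add_distrib, sum_coeff_mul_X_pow _ (hd _)]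
  conv_rhs => rw [← sum_coeff_mul_X_pow _ (hd (p /ₘ nodePoly x)), Finset.mul_sum]
  simp only [mul_smul_comm]

/-- The values and derivatives of a polynomial at the nodes. -/
def jet {k : ℕ} (x : Fin k → ℝ) : ℝ[X] →ₗ[ℝ] (Fin k × Fin 2 → ℝ) where
  toFun p q := if q.2 = 0 then p.eval (x q.1) else (derivative p).eval (x q.1)
  map_add' a b := by
    ext q
    simp only [derivative_add, eval_add, Pi.add_apply]
    split_ifs <;> rfl
  map_smul' c a := by
    ext q
    simp only [derivative_smul, eval_smul, Pi.smul_apply, RingHom.id_apply]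
    split_ifs <;> rfl

lemma jet_apply {k : ℕ} (x : Fin k → ℝ) (p : ℝ[X]) (q : Fin k × Fin 2) :
    jet x p q = if q.2 = 0 then p.eval (x q.1) else (derivative p).eval (x q.1) := rfl

/-- The matrix of values and derivatives at the nodes of the elements of `hermiteBasis`. -/
def hermiteMatrix {k : ℕ} (x : Fin k → ℝ) : Matrix (Fin k × Fin 2) (Fin k × Fin 2) ℝ :=
  Matrix.of fun p q => jet x (hermiteBasis x q) p

lemma hermiteMatrix_mulVec {k : ℕ} (x : Fin k → ℝ) (u : Fin k × Fin 2 → ℝ) :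
    hermiteMatrix x *ᵥ u = jet x (∑ q, u q • hermiteBasis x q) := by
  rw [map_sum]
  ext p
  simp only [mulVec, dotProduct, hermiteMatrix, Matrix.of_apply, map_smul, Finset.sum_apply,
    Pi.smul_apply, smul_eq_mul, mul_comm]

lemma hermiteMatrix_mulVec_hermiteCoord {k : ℕ} (x : Fin k → ℝ) (p : ℝ[X]) :
    hermiteMatrix x *ᵥ hermiteCoord x p = jet x p := by
  rw [hermiteMatrix_mulVec, sum_hermiteCoord_smul]
  have hp : p = p %ₘ nodePoly x + nodePoly x * ((p /ₘ nodePoly x) %ₘ nodePoly x) +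
      nodePoly x * nodePoly x * ((p /ₘ nodePoly x) /ₘ nodePoly x) := by
    conv_lhs => rw [← modByMonic_add_div p (nodePoly x),
      ← modByMonic_add_div (p /ₘ nodePoly x) (nodePoly x)]
    ring
  conv_rhs => rw [hp, map_add]
  rw [left_eq_add]
  ext q
  simp [jet_apply, derivative_mul, eval_nodePoly]

lemma vandermonde_prod_eq {k : ℕ} (x : Fin k → ℝ) :
    |(vandermonde x).det| =
      ∏ p ∈ Finset.univ.filter (fun p : Fin k × Fin k => p.1 < p.2), |x p.1 - x p.2| := by
  rw [det_vandermonde, Finset.abs_prod]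
  simp only [Finset.abs_prod]
  rw [Finset.prod_sigma']
  refine Finset.prod_bij' (fun a _ => (a.1, a.2)) (fun p _ => ⟨p.1, p.2⟩) ?_ ?_ ?_ ?_ ?_
  all_goals simp [abs_sub_comm]

lemma prod_abs_eval_derivative_nodePoly {k : ℕ} (x : Fin k → ℝ) :
    ∏ i, |(derivative (nodePoly x)).eval (x i)| = |(vandermonde x).det| ^ 2 := by
  have h : ∏ i, |(derivative (nodePoly x)).eval (x i)| =
      ∏ p ∈ Finset.univ.filter (fun p : Fin k × Fin k => p.1 ≠ p.2), |x p.1 - x p.2| := by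
    simp only [eval_derivative_nodePoly, Finset.abs_prod]
    rw [Finset.prod_sigma']
    refine Finset.prod_bij' (fun a _ => (a.1, a.2)) (fun p _ => ⟨p.1, p.2⟩) ?_ ?_ ?_ ?_ ?_
    all_goals simp [eq_comm]
  have hsplit : Finset.univ.filter (fun p : Fin k × Fin k => p.1 ≠ p.2) =
      Finset.univ.filter (fun p : Fin k × Fin k => p.1 < p.2) ∪
      Finset.univ.filter (fun p : Fin k × Fin k => p.2 < p.1) := by
    ext p; simp [lt_or_lt_iff_ne]
  have hdisj : Disjoint (Finset.univ.filter (fun p : Fin k × Fin k => p.1 < p.2))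
      (Finset.univ.filter (fun p : Fin k × Fin k => p.2 < p.1)) := by
    rw [Finset.disjoint_filter]
    exact fun p _ h => not_lt.2 h.le
  have hswap : ∏ p ∈ Finset.univ.filter (fun p : Fin k × Fin k => p.2 < p.1), |x p.1 - x p.2| =
      ∏ p ∈ Finset.univ.filter (fun p : Fin k × Fin k => p.1 < p.2), |x p.1 - x p.2| := by
    refine Finset.prod_bij' (fun p _ => p.swap) (fun p _ => p.swap) ?_ ?_ ?_ ?_ ?_
    all_goals simp [abs_sub_comm]
  rw [h, hsplit, Finset.prod_union hdisj, hswap, vandermonde_prod_eq, sq]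

/-- The diagonal matrix of derivatives of `nodePoly x` at the nodes times the Vandermonde matrix. -/
def nodeMatrix {k : ℕ} (x : Fin k → ℝ) : Matrix (Fin k) (Fin k) ℝ :=
  diagonal (fun i => (derivative (nodePoly x)).eval (x i)) * vandermonde x

lemma abs_det_nodeMatrix {k : ℕ} (x : Fin k → ℝ) :
    |(nodeMatrix x).det| = |(vandermonde x).det| ^ 3 := by
  rw [nodeMatrix, det_mul, det_diagonal, abs_mul, Finset.abs_prod,
    prod_abs_eval_derivative_nodePoly]
  ring

lemma nodeMatrix_mulVec {k : ℕ} (x b : Fin k → ℝ) (i : Fin k) :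
    (nodeMatrix x *ᵥ b) i =
      (derivative (nodePoly x)).eval (x i) * ∑ j, b j * x i ^ (j : ℕ) := by
  rw [nodeMatrix, ← mulVec_mulVec, mulVec_diagonal]
  simp only [mulVec, dotProduct, vandermonde_apply, mul_comm]

lemma hermiteMatrix_apply_zero {k : ℕ} (x : Fin k → ℝ) (i j : Fin k) :
    hermiteMatrix x (i, 0) (j, 1) = 0 := by
  simp [hermiteMatrix, jet_apply, hermiteBasis, eval_nodePoly]

lemma hermiteMatrix_apply_one {k : ℕ} (x : Fin k → ℝ) (i j : Fin k) :
    hermiteMatrix x (i, 1) (j, 1) = (derivative (nodePoly x)).eval (x i) * x i ^ (j : ℕ) := by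
  simp [hermiteMatrix, jet_apply, hermiteBasis, eval_nodePoly, derivative_mul]

lemma hermiteMatrix_mulVec_weylEta {k : ℕ} (x b : Fin k → ℝ) :
    hermiteMatrix x *ᵥ weylEta b = weylEta (nodeMatrix x *ᵥ b) := by
  ext ⟨i, a⟩
  have h : (hermiteMatrix x *ᵥ weylEta b) (i, a) =
      ∑ j, hermiteMatrix x (i, a) (j, 1) * b j := by
    simp [mulVec, dotProduct, Fintype.sum_prod_type, weylEta]
  rw [h]
  fin_cases a
  · simp [hermiteMatrix_apply_zero, weylEta]
  · simp only [weylEta, nodeMatrix_mulVec, Finset.mul_sum]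
    simp only [Fin.mk_one, if_true]
    refine Finset.sum_congr rfl fun j _ => ?_
    rw [hermiteMatrix_apply_one]
    ring

lemma abs_det_hermiteMatrix {k : ℕ} (x : Fin k → ℝ) :
    |(hermiteMatrix x).det| = |(vandermonde x).det| ^ 4 := by
  let e : Fin k ⊕ Fin k ≃ Fin k × Fin 2 :=
    { toFun := Sum.elim (fun i => (i, 0)) (fun i => (i, 1))
      invFun := fun p => if p.2 = 0 then Sum.inl p.1 else Sum.inr p.1
      left_inv := by rintro (i | i) <;> simp
      right_inv := by rintro ⟨i, a⟩; fin_cases a <;> simp }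
  have h : (hermiteMatrix x).submatrix e e =
      fromBlocks (vandermonde x) 0
        (Matrix.of fun i j => hermiteMatrix x (i, 1) (j, 0)) (nodeMatrix x) := by
    ext (i | i) (j | j)
    · simp [e, hermiteMatrix, jet_apply, hermiteBasis, vandermonde_apply]
    · simp [e, hermiteMatrix_apply_zero]
    · simp [e]
    · simp [e, hermiteMatrix_apply_one, nodeMatrix, diagonal_mul, vandermonde_apply]
  rw [← det_submatrix_equiv_self e, h, det_fromBlocks_zero₁₂, abs_mul, abs_det_nodeMatrix]
  ring

end HermiteInterpolation

section CovarianceBounds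

open Polynomial Matrix

lemma X_mul_divModByMonic_nodePoly {k : ℕ} (hk : 1 ≤ k) (x : Fin k → ℝ) {r : ℝ[X]}
    (hr : r.degree < k) :
    (X * r) /ₘ nodePoly x = C (r.coeff (k - 1)) ∧
      (X * r) %ₘ nodePoly x = X * r - C (r.coeff (k - 1)) * nodePoly x := by
  refine div_modByMonic_unique _ _ (nodePoly_monic x) ⟨by ring, ?_⟩
  rw [nodePoly_degree, degree_lt_iff_coeff_zero]
  intro m hm
  obtain ⟨m, rfl⟩ : ∃ l, m = l + 1 := ⟨m - 1, by omega⟩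
  rw [coeff_sub, coeff_X_mul, coeff_C_mul]
  rcases hm.eq_or_lt with h | h
  · have h1 : (nodePoly x).coeff (m + 1) = 1 := by
      rw [← h]
      simpa [Monic, leadingCoeff, nodePoly_natDegree] using nodePoly_monic x
    rw [h1, h]
    simp
  · rw [coeff_eq_zero_of_degree_lt (hr.trans_le (by exact_mod_cast Nat.le_of_lt_succ h)),
      coeff_eq_zero_of_natDegree_lt (p := nodePoly x) (by rw [nodePoly_natDegree]; exact h)]
    simp

lemma abs_coeff_X_mul_modByMonic_le {k : ℕ} (hk : 1 ≤ k) (x : Fin k → ℝ) {B R : ℝ}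
    (hB : ∀ n, |(nodePoly x).coeff n| ≤ B) {r : ℝ[X]} (hr : r.degree < k)
    (hR : ∀ n, |r.coeff n| ≤ R) (n : ℕ) :
    |((X * r) %ₘ nodePoly x).coeff n| ≤ (1 + B) * R := by
  have hR0 : 0 ≤ R := (abs_nonneg _).trans (hR 0)
  rw [(X_mul_divModByMonic_nodePoly hk x hr).2, coeff_sub, coeff_C_mul]
  have h1 : |(X * r).coeff n| ≤ R := by
    cases n with
    | zero => simpa using hR0
    | succ m => rw [coeff_X_mul]; exact hR m
  have h2 : |r.coeff (k - 1) * (nodePoly x).coeff n| ≤ R * B := by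
    rw [abs_mul]
    exact mul_le_mul (hR _) (hB n) (abs_nonneg _) hR0
  calc _ ≤ _ := abs_sub _ _
    _ ≤ R + R * B := add_le_add h1 h2
    _ = _ := by ring

lemma X_mul_divModByMonic {k : ℕ} (hk : 1 ≤ k) (x : Fin k → ℝ) (p : ℝ[X]) :
    (X * p) /ₘ nodePoly x =
        C ((p %ₘ nodePoly x).coeff (k - 1)) + X * (p /ₘ nodePoly x) ∧
      (X * p) %ₘ nodePoly x = (X * (p %ₘ nodePoly x)) %ₘ nodePoly x := by
  have h := nodePoly_monic x
  have hd : (p %ₘ nodePoly x).degree < k := nodePoly_degree x ▸ degree_modByMonic_lt p h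
  have hp : X * p = X * (p %ₘ nodePoly x) + nodePoly x * (X * (p /ₘ nodePoly x)) := by
    conv_lhs => rw [← modByMonic_add_div p (nodePoly x)]
    ring
  have := add_divModByMonic h (X * (p %ₘ nodePoly x)) (nodePoly x * (X * (p /ₘ nodePoly x)))
  rw [← hp, mul_divByMonic_cancel_left _ h, self_mul_modByMonic h, add_zero,
    (X_mul_divModByMonic_nodePoly hk x hd).1] at this
  exact this

lemma abs_hermiteCoord_X_pow_le {k : ℕ} (hk : 1 ≤ k) (x : Fin k → ℝ) {B : ℝ}
    (hB : ∀ n, |(nodePoly x).coeff n| ≤ B) (n : ℕ) (q : Fin k × Fin 2) :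
    |hermiteCoord x (X ^ n) q| ≤ (2 + B) ^ n := by
  have h := nodePoly_monic x
  have hB0 : 0 ≤ B := (abs_nonneg _).trans (hB 0)
  have hd : ∀ p : ℝ[X], (p %ₘ nodePoly x).degree < k := fun p =>
    nodePoly_degree x ▸ degree_modByMonic_lt p h
  have hconst : ∀ c : ℝ, (C c) %ₘ nodePoly x = C c ∧ (C c) /ₘ nodePoly x = 0 := fun c => by
    have : (C c).degree < (nodePoly x).degree := by
      rw [nodePoly_degree]
      exact degree_C_le.trans_lt (by exact_mod_cast hk)
    exact ⟨(modByMonic_eq_self_iff h).2 this, (divByMonic_eq_zero_iff h).2 this⟩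
  have habsC : ∀ (c : ℝ) (m : ℕ), |(C c).coeff m| ≤ |c| := fun c m => by
    rw [coeff_C]
    split_ifs <;> simp
  have key : (∀ m, |((X ^ n : ℝ[X]) %ₘ nodePoly x).coeff m| ≤ (2 + B) ^ n) ∧
      (∀ m, |(((X ^ n : ℝ[X]) /ₘ nodePoly x) %ₘ nodePoly x).coeff m| ≤ (2 + B) ^ n) := by
    induction n with
    | zero =>
      rw [pow_zero, ← C_1, (hconst 1).1, (hconst 1).2, zero_modByMonic]
      exact ⟨fun m => by simpa using habsC 1 m, fun m => by simp⟩
    | succ n ih =>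
      have hpos : (0 : ℝ) ≤ (2 + B) ^ n := by positivity
      have hX := X_mul_divModByMonic hk x (X ^ n)
      rw [pow_succ', hX.1, hX.2, (add_divModByMonic h _ _).2, (hconst _).1,
        (X_mul_divModByMonic hk x (X ^ n /ₘ nodePoly x)).2]
      refine ⟨fun m => ?_, fun m => ?_⟩
      · refine (abs_coeff_X_mul_modByMonic_le hk x hB (hd _) ih.1 m).trans ?_
        rw [pow_succ']
        nlinarith
      · rw [coeff_add, pow_succ']
        refine (abs_add_le _ _).trans ?_
        have h1 := (habsC ((X ^ n %ₘ nodePoly x).coeff (k - 1)) m).trans (ih.1 (k - 1))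
        have h2 := abs_coeff_X_mul_modByMonic_le hk x hB (hd _) ih.2 m
        nlinarith
  rw [hermiteCoord_apply]
  split_ifs
  · exact key.1 _
  · exact key.2 _

lemma dotProduct_sq_le {ι : Type*} [Fintype ι] (u v : ι → ℝ) :
    (u ⬝ᵥ v) ^ 2 ≤ (u ⬝ᵥ u) * (v ⬝ᵥ v) := by
  simpa [dotProduct, sq] using Finset.sum_mul_sq_le_sq_mul_sq Finset.univ u v

lemma hasSum_pow_div_factorial (z : ℝ) :
    HasSum (fun n : ℕ => z ^ n / (n.factorial : ℝ)) (Real.exp z) := by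
  rw [Real.exp_eq_exp_ℝ]
  exact NormedSpace.expSeries_div_hasSum_exp z

lemma hasSum_hermiteCoord_bounds {M : ℝ} (hM : 0 ≤ M) {k : ℕ} (hk : 1 ≤ k) :
    ∃ c C : ℝ, 0 < c ∧ 0 < C ∧ ∀ x : Fin k → ℝ, (∀ i, |x i| ≤ M) →
      ∀ (u : Fin k × Fin 2 → ℝ) (S : ℝ),
        HasSum (fun n : ℕ => (u ⬝ᵥ hermiteCoord x (X ^ n)) ^ 2 / (n.factorial : ℝ)) S →
        c * (u ⬝ᵥ u) ≤ S ∧ S ≤ C * (u ⬝ᵥ u) := by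
  set B : ℝ := (1 + M) ^ k
  have hB0 : 0 < B := by positivity
  set N : ℝ := ((Fintype.card (Fin k × Fin 2) : ℕ) : ℝ) with hN
  have hN0 : 0 < N := by
    rw [hN]
    have : 0 < k := hk
    simp [this]
  set A : ℝ := N * ((2 * k : ℕ) * B ^ 2 * (2 * k).factorial) with hA
  have hk0 : (0 : ℝ) < (2 * k : ℕ) := by exact_mod_cast (by omega : 0 < 2 * k)
  have hA0 : 0 < A := by positivity
  refine ⟨A⁻¹, N * Real.exp ((2 + B) ^ 2), by positivity, by positivity, fun x hx u S hS => ?_⟩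
  have huu : 0 ≤ u ⬝ᵥ u := by
    simpa [dotProduct] using Finset.sum_nonneg fun i _ => mul_self_nonneg (u i)
  constructor
  · rw [inv_mul_le_iff₀ hA0]
    have hcoord : ∀ q, u q ^ 2 ≤ (2 * k : ℕ) * B ^ 2 * (2 * k).factorial * S := by
      intro q
      have hq : u q = ∑ n ∈ Finset.range (2 * k),
          (hermiteBasis x q).coeff n * (u ⬝ᵥ hermiteCoord x (X ^ n)) := by
        have h1 : u q = u ⬝ᵥ hermiteCoord x (hermiteBasis x q) := by
          rw [hermiteCoord_hermiteBasis]
          simp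
        rw [h1]
        conv_lhs => rw [(hermiteBasis x q).as_sum_range_C_mul_X_pow'
          (natDegree_hermiteBasis_lt x q)]
        simp only [← smul_eq_C_mul, map_sum, map_smul, dotProduct_sum, dotProduct_smul,
          smul_eq_mul]
      have h2 : ∑ n ∈ Finset.range (2 * k), (hermiteBasis x q).coeff n ^ 2 ≤
          (2 * k : ℕ) * B ^ 2 := by
        calc _ ≤ ∑ n ∈ Finset.range (2 * k), B ^ 2 :=
              Finset.sum_le_sum fun n _ =>
                sq_le_sq' (abs_le.1 (abs_coeff_hermiteBasis_le hM x hx q n)).1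
                  (abs_le.1 (abs_coeff_hermiteBasis_le hM x hx q n)).2
          _ = _ := by simp
      have h3 : ∑ n ∈ Finset.range (2 * k), (u ⬝ᵥ hermiteCoord x (X ^ n)) ^ 2 ≤
          (2 * k).factorial * S := by
        calc _ ≤ ∑ n ∈ Finset.range (2 * k), ((2 * k).factorial : ℝ) *
                ((u ⬝ᵥ hermiteCoord x (X ^ n)) ^ 2 / (n.factorial : ℝ)) := by
              refine Finset.sum_le_sum fun n hn => ?_
              rw [← mul_div_assoc, le_div_iff₀ (by positivity), mul_comm]
              gcongr
              exact (Finset.mem_range.1 hn).le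
          _ = (2 * k).factorial * ∑ n ∈ Finset.range (2 * k),
                ((u ⬝ᵥ hermiteCoord x (X ^ n)) ^ 2 / (n.factorial : ℝ)) :=
              (Finset.mul_sum _ _ _).symm
          _ ≤ _ := by
              gcongr
              exact sum_le_hasSum _ (fun n _ => by positivity) hS
      rw [hq]
      refine (Finset.sum_mul_sq_le_sq_mul_sq _ _ _).trans ?_
      rw [mul_assoc]
      calc _ ≤ ((2 * k : ℕ) * B ^ 2) * ((2 * k).factorial * S) :=
            mul_le_mul h2 h3 (Finset.sum_nonneg fun n _ => sq_nonneg _) (by positivity)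
        _ = _ := by ring
    calc u ⬝ᵥ u = ∑ q, u q ^ 2 := by simp [dotProduct, sq]
      _ ≤ ∑ q : Fin k × Fin 2, (2 * k : ℕ) * B ^ 2 * (2 * k).factorial * S :=
          Finset.sum_le_sum fun q _ => hcoord q
      _ = A * S := by
          rw [Finset.sum_const, Finset.card_univ, nsmul_eq_mul, hA]
          ring
  · have hT := (hasSum_pow_div_factorial ((2 + B) ^ 2)).mul_left ((u ⬝ᵥ u) * N)
    refine (hasSum_le (fun n => ?_) hS hT).trans_eq (by ring)
    rw [← mul_div_assoc]
    gcongr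
    refine (dotProduct_sq_le _ _).trans ?_
    rw [mul_assoc]
    refine mul_le_mul_of_nonneg_left ?_ huu
    calc hermiteCoord x (X ^ n) ⬝ᵥ hermiteCoord x (X ^ n)
        = ∑ q, hermiteCoord x (X ^ n) q ^ 2 := by simp [dotProduct, sq]
      _ ≤ ∑ q : Fin k × Fin 2, ((2 + B) ^ n) ^ 2 := Finset.sum_le_sum fun q _ => by
          have := abs_hermiteCoord_X_pow_le hk x (abs_coeff_nodePoly_le hM x hx) n q
          exact sq_le_sq' (abs_le.1 this).1 (abs_le.1 this).2
      _ = N * ((2 + B) ^ 2) ^ n := by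
          rw [Finset.sum_const, Finset.card_univ, nsmul_eq_mul, ← pow_mul, ← pow_mul, mul_comm n]

lemma hasSum_weylCov (s t : ℝ) (a b : Fin 2) :
    HasSum (fun n : ℕ => (if a = 0 then s ^ n else n * s ^ (n - 1)) *
      (if b = 0 then t ^ n else n * t ^ (n - 1)) / (n.factorial : ℝ)) (weylCov s t a b) := by
  have h0 := hasSum_pow_div_factorial (s * t)
  have hshift : ∀ (f : ℕ → ℝ) (S : ℝ), f 0 = 0 → HasSum (fun n => f (n + 1)) S → HasSum f S :=
    fun f S hf h => by simpa [hf] using (hasSum_nat_add_iff 1).1 h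
  have h1 : HasSum (fun n : ℕ => n * ((s * t) ^ n / (n.factorial : ℝ)))
      (s * t * Real.exp (s * t)) := by
    refine hshift _ _ (by simp) ((h0.mul_left (s * t)).congr_fun ?_)
    intro n
    rw [Nat.factorial_succ]
    push_cast
    field_simp
    ring
  fin_cases a <;> fin_cases b
  · simpa [weylCov, mul_pow] using h0
  · refine hshift _ _ (by simp) ?_
    simp only [weylCov]
    refine (h0.mul_left s).congr_fun fun n => ?_
    rw [Nat.factorial_succ]
    simp
    field_simp
    ring
  · refine hshift _ _ (by simp) ?_
    simp only [weylCov]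
    refine (h0.mul_left t).congr_fun fun n => ?_
    rw [Nat.factorial_succ]
    simp
    field_simp
    ring
  · refine hshift _ _ (by simp) ?_
    have h2 := h0.add h1
    have h3 : weylCov s t 1 1 = Real.exp (s * t) + s * t * Real.exp (s * t) := by
      simp [weylCov]; ring
    simp only [Fin.mk_one, h3]
    refine h2.congr_fun fun n => ?_
    rw [Nat.factorial_succ]
    simp
    field_simp
    ring

lemma hasSum_weylGamma {k : ℕ} (x : Fin k → ℝ) (y : Fin k × Fin 2 → ℝ) :
    HasSum (fun n : ℕ => (y ⬝ᵥ jet x (X ^ n)) ^ 2 / (n.factorial : ℝ))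
      (y ⬝ᵥ weylGamma x *ᵥ y) := by
  have hjet : ∀ (n : ℕ) (q : Fin k × Fin 2),
      jet x (X ^ n) q = if q.2 = 0 then x q.1 ^ n else n * x q.1 ^ (n - 1) := by
    intro n q
    simp [jet_apply, derivative_X_pow]
  have h : HasSum (fun n : ℕ => ∑ p, ∑ q, y p * y q *
      (jet x (X ^ n) p * jet x (X ^ n) q / (n.factorial : ℝ)))
      (∑ p, ∑ q, y p * y q * weylGamma x p q) := by
    refine hasSum_sum fun p _ => hasSum_sum fun q _ => ?_
    simp only [hjet]
    exact (hasSum_weylCov _ _ _ _).mul_left _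
  convert h using 1
  · ext n
    rw [sq, dotProduct, Finset.sum_mul_sum, Finset.sum_div]
    refine Finset.sum_congr rfl fun p _ => ?_
    rw [Finset.sum_div]
    refine Finset.sum_congr rfl fun q _ => ?_
    ring
  · simp only [dotProduct, mulVec, Finset.mul_sum]
    refine Finset.sum_congr rfl fun p _ => Finset.sum_congr rfl fun q _ => ?_
    ring

lemma weylGamma_transpose {k : ℕ} (x : Fin k → ℝ) : (weylGamma x)ᵀ = weylGamma x := by
  ext ⟨i, a⟩ ⟨j, b⟩
  fin_cases a <;> fin_cases b <;> simp [weylGamma, weylCov, mul_comm]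

/-- The covariance matrix of the coordinates of the Weyl series in `hermiteBasis x`. -/
def hermiteCov {k : ℕ} (x : Fin k → ℝ) : Matrix (Fin k × Fin 2) (Fin k × Fin 2) ℝ :=
  (hermiteMatrix x)⁻¹ * weylGamma x * ((hermiteMatrix x)⁻¹)ᵀ

lemma hermiteCov_isHermitian {k : ℕ} (x : Fin k → ℝ) : (hermiteCov x).IsHermitian := by
  rw [IsHermitian, conjTranspose_eq_transpose_of_trivial, hermiteCov, transpose_mul,
    transpose_mul, transpose_transpose, weylGamma_transpose, mul_assoc]

lemma det_vandermonde_ne_zero {k : ℕ} {x : Fin k → ℝ} (hx : Function.Injective x) :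
    (vandermonde x).det ≠ 0 := det_vandermonde_ne_zero_iff.2 hx

lemma isUnit_det_hermiteMatrix {k : ℕ} {x : Fin k → ℝ} (hx : Function.Injective x) :
    IsUnit (hermiteMatrix x).det := by
  rw [isUnit_iff_ne_zero, ← abs_ne_zero, abs_det_hermiteMatrix]
  exact pow_ne_zero _ (abs_ne_zero.2 (det_vandermonde_ne_zero hx))

lemma weylGamma_eq {k : ℕ} {x : Fin k → ℝ} (hx : Function.Injective x) :
    weylGamma x = hermiteMatrix x * hermiteCov x * (hermiteMatrix x)ᵀ := by
  have h := isUnit_det_hermiteMatrix hx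
  have h' : ((hermiteMatrix x)⁻¹)ᵀ * (hermiteMatrix x)ᵀ = 1 := by
    rw [← transpose_mul, mul_nonsing_inv _ h, transpose_one]
  rw [hermiteCov, mul_assoc, mul_assoc, mul_assoc, h', mul_one, ← mul_assoc,
    mul_nonsing_inv _ h, one_mul]

lemma hermiteCov_bounds {M : ℝ} (hM : 0 ≤ M) {k : ℕ} (hk : 1 ≤ k) :
    ∃ c C : ℝ, 0 < c ∧ 0 < C ∧ ∀ x : Fin k → ℝ, Function.Injective x → (∀ i, |x i| ≤ M) →
      ∀ u : Fin k × Fin 2 → ℝ, c * (u ⬝ᵥ u) ≤ u ⬝ᵥ hermiteCov x *ᵥ u ∧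
        u ⬝ᵥ hermiteCov x *ᵥ u ≤ C * (u ⬝ᵥ u) := by
  obtain ⟨c, C, hc, hC, H⟩ := hasSum_hermiteCoord_bounds hM hk
  refine ⟨c, C, hc, hC, fun x hx hxM u => H x hxM u _ ?_⟩
  have hW := isUnit_det_hermiteMatrix hx
  have h := hasSum_weylGamma x (((hermiteMatrix x)⁻¹)ᵀ *ᵥ u)
  have hu : ∀ v, ((hermiteMatrix x)⁻¹)ᵀ *ᵥ u ⬝ᵥ v = u ⬝ᵥ (hermiteMatrix x)⁻¹ *ᵥ v := fun v => by
    rw [mulVec_transpose, dotProduct_mulVec]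
  convert h using 1
  · ext n
    rw [hu, ← hermiteMatrix_mulVec_hermiteCoord, mulVec_mulVec, nonsing_inv_mul _ hW, one_mulVec]
  · rw [hu, mulVec_mulVec, mulVec_mulVec, hermiteCov, mul_assoc]

end CovarianceBounds

section FormBounds

open Matrix

variable {ι : Type*} [Fintype ι] [DecidableEq ι]

lemma det_bounds_of_form_bounds {A : Matrix ι ι ℝ} (hA : A.IsHermitian) {c C : ℝ} (hc : 0 < c)
    (h : ∀ u, c * (u ⬝ᵥ u) ≤ u ⬝ᵥ A *ᵥ u ∧ u ⬝ᵥ A *ᵥ u ≤ C * (u ⬝ᵥ u)) :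
    c ^ Fintype.card ι ≤ A.det ∧ A.det ≤ C ^ Fintype.card ι := by
  have hev : ∀ i, c ≤ hA.eigenvalues i ∧ hA.eigenvalues i ≤ C := by
    intro i
    have h1 : (hA.eigenvectorBasis i : ι → ℝ) ⬝ᵥ (hA.eigenvectorBasis i : ι → ℝ) = 1 := by
      have := hA.eigenvectorBasis.orthonormal.1 i
      rw [EuclideanSpace.norm_eq, Real.sqrt_eq_one] at this
      simpa [dotProduct, sq] using this
    have h2 := h (hA.eigenvectorBasis i)
    rw [hA.mulVec_eigenvectorBasis, dotProduct_smul, h1] at h2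
    simpa using h2
  rw [hA.det_eq_prod_eigenvalues]
  simp only [RCLike.ofReal_real_eq_id, id]
  constructor
  · calc c ^ Fintype.card ι = ∏ _i : ι, c := by simp
      _ ≤ _ := Finset.prod_le_prod (fun _ _ => hc.le) fun i _ => (hev i).1
  · calc _ ≤ ∏ _i : ι, C :=
          Finset.prod_le_prod (fun i _ => hc.le.trans (hev i).1) fun i _ => (hev i).2
      _ = _ := by simp

lemma inv_form_bounds_of_form_bounds {A : Matrix ι ι ℝ} (hA : A.IsHermitian) {c C : ℝ}
    (hc : 0 < c) (hC : 0 < C)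
    (h : ∀ u, c * (u ⬝ᵥ u) ≤ u ⬝ᵥ A *ᵥ u ∧ u ⬝ᵥ A *ᵥ u ≤ C * (u ⬝ᵥ u)) (u : ι → ℝ) :
    C⁻¹ * (u ⬝ᵥ u) ≤ A⁻¹ *ᵥ u ⬝ᵥ u ∧ A⁻¹ *ᵥ u ⬝ᵥ u ≤ c⁻¹ * (u ⬝ᵥ u) := by
  have hdet : IsUnit A.det := by
    rw [isUnit_iff_ne_zero]
    exact ((pow_pos hc _).trans_le (det_bounds_of_form_bounds hA hc h).1).ne'
  set v := A⁻¹ *ᵥ u with hv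
  have hAv : A *ᵥ v = u := by
    rw [hv, mulVec_mulVec, mul_nonsing_inv _ hdet, one_mulVec]
  have hnonneg : ∀ w : ι → ℝ, 0 ≤ w ⬝ᵥ w := fun w =>
    Finset.sum_nonneg fun i _ => mul_self_nonneg (w i)
  constructor
  · have h1 : 0 ≤ (v - C⁻¹ • u) ⬝ᵥ A *ᵥ (v - C⁻¹ • u) :=
      (mul_nonneg hc.le (hnonneg _)).trans (h _).1
    have hsymm : v ⬝ᵥ A *ᵥ u = u ⬝ᵥ u := by
      rw [dotProduct_mulVec, ← mulVec_transpose, ← conjTranspose_eq_transpose_of_trivial, hA.eq,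
        hAv]
    rw [mulVec_sub, mulVec_smul, hAv, sub_dotProduct, dotProduct_sub, dotProduct_sub,
      smul_dotProduct, smul_dotProduct, dotProduct_smul, dotProduct_smul, hsymm] at h1
    simp only [smul_eq_mul] at h1
    have h2 : C⁻¹ * (C⁻¹ * (u ⬝ᵥ A *ᵥ u)) ≤ C⁻¹ * (u ⬝ᵥ u) := by
      gcongr
      rw [inv_mul_le_iff₀ hC]
      exact (h u).2
    linarith
  · have h1 : 0 ≤ (v - c⁻¹ • u) ⬝ᵥ (v - c⁻¹ • u) := hnonneg _
    have h2 := (h v).1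
    rw [hAv] at h2
    rw [sub_dotProduct, dotProduct_sub, dotProduct_sub, smul_dotProduct, smul_dotProduct,
      dotProduct_smul, dotProduct_smul, dotProduct_comm u v] at h1
    simp only [smul_eq_mul] at h1
    have h3 : v ⬝ᵥ v ≤ c⁻¹ * (v ⬝ᵥ u) := by
      rwa [le_inv_mul_iff₀ hc]
    have h4 : c⁻¹ * (v ⬝ᵥ u) ≤ c⁻¹ * (c⁻¹ * (u ⬝ᵥ u)) := by linarith
    exact le_of_mul_le_mul_left h4 (inv_pos.2 hc)

lemma integral_comp_mulVec {L : Matrix ι ι ℝ} (hL : L.det ≠ 0) (g : (ι → ℝ) → ℝ) :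
    ∫ v, g v = |L.det| * ∫ b, g (L *ᵥ b) := by
  have hinj : Function.Injective (fun b : ι → ℝ => L *ᵥ b) :=
    mulVec_injective_iff_isUnit.2 ((isUnit_iff_isUnit_det L).2 (isUnit_iff_ne_zero.2 hL))
  have hsurj : Function.Surjective (fun b : ι → ℝ => L *ᵥ b) :=
    mulVec_surjective_iff_isUnit.2 ((isUnit_iff_isUnit_det L).2 (isUnit_iff_ne_zero.2 hL))
  have h := integral_image_eq_integral_abs_det_fderiv_smul volume MeasurableSet.univ
    (f := fun b : ι → ℝ => L *ᵥ b) (f' := fun _ => (toLin' L).toContinuousLinearMap)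
    (fun b _ => (toLin' L).toContinuousLinearMap.hasFDerivWithinAt) hinj.injOn g
  rw [Set.image_univ, hsurj.range_eq] at h
  simpa [ContinuousLinearMap.det, integral_const_mul] using h

end FormBounds

section GaussianIntegrals

variable {k : ℕ}

lemma prod_abs_mul_exp_le {M A c : ℝ} (hM : 0 ≤ M) (hc : 0 < c) (hA : (1 + M) ^ k ≤ A)
    {x : Fin k → ℝ} (hx : ∀ i, |x i| ≤ M) {F : ℝ} {b : Fin k → ℝ} (hF : c * ∑ j, b j ^ 2 ≤ F) :
    (∏ i, |∑ j, b j * x i ^ (j : ℕ)|) * Real.exp (-(1 / 2) * F) ≤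
      A ^ k * ∏ j, (Real.exp ((k : ℝ) ^ 2 / c) * Real.exp (-(c / 4) * b j ^ 2)) := by
  have hA0 : 0 ≤ A := le_trans (by positivity) hA
  have h1 : ∀ i, |∑ j, b j * x i ^ (j : ℕ)| ≤ A * Real.exp (∑ j, |b j|) := by
    intro i
    have h2 : |∑ j, b j * x i ^ (j : ℕ)| ≤ A * ∑ j, |b j| := by
      rw [Finset.mul_sum]
      refine (Finset.abs_sum_le_sum_abs _ _).trans (Finset.sum_le_sum fun j _ => ?_)
      rw [abs_mul, abs_pow, mul_comm]
      gcongr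
      calc |x i| ^ (j : ℕ) ≤ (1 + M) ^ (j : ℕ) := by
            gcongr
            linarith [hx i]
        _ ≤ (1 + M) ^ k := pow_le_pow_right₀ (by linarith) j.isLt.le
        _ ≤ A := hA
    refine h2.trans (mul_le_mul_of_nonneg_left ?_ hA0)
    linarith [Real.add_one_le_exp (∑ j, |b j|)]
  calc _ ≤ (∏ _i : Fin k, A * Real.exp (∑ j, |b j|)) * Real.exp (-(1 / 2) * F) := by
        gcongr with i
        exact h1 i
    _ = A ^ k * Real.exp (k * ∑ j, |b j| + -(1 / 2) * F) := by
        rw [Finset.prod_const, Finset.card_univ, Fintype.card_fin, mul_pow, ← Real.exp_nat_mul,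
          mul_assoc, ← Real.exp_add]
    _ ≤ A ^ k * ∏ j, (Real.exp ((k : ℝ) ^ 2 / c) * Real.exp (-(c / 4) * b j ^ 2)) := by
        gcongr
        simp only [← Real.exp_add]
        rw [← Real.exp_sum]
        refine Real.exp_le_exp.2 ?_
        have h3 : ∀ j, (k : ℝ) * |b j| - c / 2 * b j ^ 2 ≤
            (k : ℝ) ^ 2 / c + -(c / 4) * b j ^ 2 := by
          intro j
          have h4 : 0 ≤ (c / 2 * |b j| - k) ^ 2 / c := by positivity
          have h5 : (c / 2 * |b j| - k) ^ 2 / c =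
              c / 4 * b j ^ 2 - k * |b j| + (k : ℝ) ^ 2 / c := by
            rw [← sq_abs (b j)]
            field_simp
            ring
          linarith
        have h6 := Finset.sum_le_sum fun j (_ : j ∈ Finset.univ) => h3 j
        rw [Finset.sum_sub_distrib, ← Finset.mul_sum, ← Finset.mul_sum] at h6
        linarith

lemma le_prod_abs_mul_exp {M A C : ℝ} (hk : 1 ≤ k) (hM : 0 ≤ M) (hC : 0 ≤ C)
    (hA : (1 + M) ^ k ≤ A) {x : Fin k → ℝ} (hx : ∀ i, |x i| ≤ M) {F : ℝ} {b : Fin k → ℝ}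
    (hF : F ≤ C * ∑ j, b j ^ 2)
    (hb : ∀ j, |b j - (Pi.single ⟨0, hk⟩ 1 : Fin k → ℝ) j| ≤ 1 / (2 * k * A)) :
    (1 / 2) ^ k * Real.exp (-(1 / 2) * (C * (k * 4))) ≤
      (∏ i, |∑ j, b j * x i ^ (j : ℕ)|) * Real.exp (-(1 / 2) * F) := by
  have hk0 : (1 : ℝ) ≤ k := by exact_mod_cast hk
  have hA1 : 1 ≤ A := (one_le_pow₀ (by linarith)).trans hA
  have hA0 : 0 < A := by linarith
  set e : Fin k → ℝ := Pi.single ⟨0, hk⟩ 1 with he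
  have heps : 1 / (2 * k * A) ≤ 1 := by
    rw [div_le_one (by positivity)]
    nlinarith
  have hlow : ∀ i, 1 / 2 ≤ |∑ j, b j * x i ^ (j : ℕ)| := by
    intro i
    have h1 : ∑ j, e j * x i ^ (j : ℕ) = 1 := by
      simp [he, Pi.single_apply]
    have h2 : ∑ j, b j * x i ^ (j : ℕ) = 1 + ∑ j, (b j - e j) * x i ^ (j : ℕ) := by
      simp only [sub_mul, Finset.sum_sub_distrib, h1]
      ring
    have h3 : |∑ j, (b j - e j) * x i ^ (j : ℕ)| ≤ 1 / 2 := by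
      calc _ ≤ ∑ j, |(b j - e j) * x i ^ (j : ℕ)| := Finset.abs_sum_le_sum_abs _ _
        _ ≤ ∑ _j : Fin k, 1 / (2 * k * A) * A := by
            refine Finset.sum_le_sum fun j _ => ?_
            rw [abs_mul, abs_pow]
            refine mul_le_mul (hb j) ?_ (by positivity) (by positivity)
            calc |x i| ^ (j : ℕ) ≤ (1 + M) ^ (j : ℕ) := by
                  gcongr
                  linarith [hx i]
              _ ≤ (1 + M) ^ k := pow_le_pow_right₀ (by linarith) j.isLt.le
              _ ≤ A := hA
        _ = 1 / 2 := by
            rw [Finset.sum_const, Finset.card_univ, Fintype.card_fin, nsmul_eq_mul]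
            field_simp
    rw [h2]
    exact le_trans (by linarith [(abs_le.1 h3).1]) (le_abs_self _)
  have hsum : ∑ j, b j ^ 2 ≤ k * 4 := by
    calc ∑ j, b j ^ 2 ≤ ∑ _j : Fin k, (4 : ℝ) := by
          refine Finset.sum_le_sum fun j _ => ?_
          have h1 : |e j| ≤ 1 := by
            rw [he, Pi.single_apply]
            split_ifs <;> simp
          have h2 := abs_le.1 ((hb j).trans heps)
          have h3 := abs_le.1 h1
          nlinarith
      _ = k * 4 := by simp
  have hprod : (1 / 2 : ℝ) ^ k ≤ ∏ i, |∑ j, b j * x i ^ (j : ℕ)| := by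
    calc (1 / 2 : ℝ) ^ k = ∏ _i : Fin k, (1 / 2 : ℝ) := by simp
      _ ≤ _ := Finset.prod_le_prod (fun _ _ => by norm_num) fun i _ => hlow i
  refine mul_le_mul hprod (Real.exp_le_exp.2 ?_) (Real.exp_pos _).le
    ((by positivity : (0 : ℝ) ≤ (1 / 2) ^ k).trans hprod)
  have := hF.trans (mul_le_mul_of_nonneg_left hsum hC)
  linarith

lemma integral_prod_abs_mul_exp_bounds {M c C : ℝ} (hk : 1 ≤ k) (hM : 0 ≤ M) (hc : 0 < c)
    (hC : 0 ≤ C) : ∃ m U : ℝ, 0 < m ∧ 0 < U ∧ ∀ x : Fin k → ℝ, (∀ i, |x i| ≤ M) →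
      ∀ F : (Fin k → ℝ) → ℝ, Continuous F →
        (∀ b, c * ∑ j, b j ^ 2 ≤ F b ∧ F b ≤ C * ∑ j, b j ^ 2) →
        m ≤ ∫ b : Fin k → ℝ, (∏ i, |∑ j, b j * x i ^ (j : ℕ)|) * Real.exp (-(1 / 2) * F b) ∧
          ∫ b : Fin k → ℝ, (∏ i, |∑ j, b j * x i ^ (j : ℕ)|) * Real.exp (-(1 / 2) * F b) ≤ U := by
  set A : ℝ := (1 + M) ^ k with hA
  set G : (Fin k → ℝ) → ℝ := fun b =>
    A ^ k * ∏ j, (Real.exp ((k : ℝ) ^ 2 / c) * Real.exp (-(c / 4) * b j ^ 2)) with hG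
  have hGint : Integrable G := by
    refine Integrable.const_mul (Integrable.fintype_prod
      (f := fun (_ : Fin k) t => Real.exp ((k : ℝ) ^ 2 / c) * Real.exp (-(c / 4) * t ^ 2))
      fun j => ?_) _
    exact (integrable_exp_neg_mul_sq (by positivity)).const_mul _
  set ε : ℝ := 1 / (2 * k * A) with hε
  have hk0 : (0 : ℝ) < k := by exact_mod_cast hk
  have hA0 : 0 < A := by positivity
  have hε0 : 0 < ε := by positivity
  set e : Fin k → ℝ := Pi.single ⟨0, hk⟩ 1 with he
  set S : Set (Fin k → ℝ) := Set.Icc (fun j => e j - ε) (fun j => e j + ε) with hS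
  set m₀ : ℝ := (1 / 2) ^ k * Real.exp (-(1 / 2) * (C * (k * 4))) with hm₀
  have hm₀0 : 0 < m₀ := by positivity
  have hm : 0 < m₀ * (2 * ε) ^ k := by positivity
  refine ⟨m₀ * (2 * ε) ^ k, max 1 (∫ b, G b), hm, by positivity, fun x hx F hFc hF => ?_⟩
  set f : (Fin k → ℝ) → ℝ := fun b =>
    (∏ i, |∑ j, b j * x i ^ (j : ℕ)|) * Real.exp (-(1 / 2) * F b) with hf
  have hf0 : ∀ b, 0 ≤ f b := fun b => by positivity
  have hfG : ∀ b, f b ≤ G b := fun b => prod_abs_mul_exp_le hM hc le_rfl hx (hF b).1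
  have hfint : Integrable f := by
    refine hGint.mono' (Continuous.aestronglyMeasurable (by fun_prop)) (.of_forall fun b => ?_)
    rw [Real.norm_of_nonneg (hf0 b)]
    exact hfG b
  refine ⟨?_, (integral_mono hfint hGint hfG).trans (le_max_right _ _)⟩
  have hvol : (volume S).toReal = (2 * ε) ^ k := by
    rw [hS, Real.volume_Icc_pi_toReal (fun j => by linarith)]
    simp only [add_sub_sub_cancel, Finset.prod_const, Finset.card_univ, Fintype.card_fin]
    ring
  calc m₀ * (2 * ε) ^ k = ∫ _b in S, m₀ := by
        rw [setIntegral_const, smul_eq_mul, Measure.real, hvol, mul_comm]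
    _ ≤ ∫ b in S, f b := by
        refine setIntegral_mono_on ?_ hfint.integrableOn measurableSet_Icc fun b hb => ?_
        · exact integrableOn_const (isCompact_Icc.measure_lt_top.ne)
        · refine le_prod_abs_mul_exp hk hM hC le_rfl hx (hF b).2 fun j => ?_
          rw [abs_le]
          have h1 := hb.1 j
          have h2 := hb.2 j
          simp only at h1 h2
          constructor <;> linarith
    _ ≤ ∫ b, f b := setIntegral_le_integral hfint (.of_forall hf0)

end GaussianIntegrals

section Correlation

open Matrix

lemma weylEta_dotProduct_self {k : ℕ} (b : Fin k → ℝ) :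
    weylEta b ⬝ᵥ weylEta b = ∑ j, b j ^ 2 := by
  simp [dotProduct, Fintype.sum_prod_type, weylEta, sq]

/-- The quadratic form of the conditional density of the quotient of the Weyl series by
`nodePoly x` given that it vanishes at the nodes. -/
def quotientForm {k : ℕ} (x b : Fin k → ℝ) : ℝ :=
  (hermiteCov x)⁻¹ *ᵥ weylEta b ⬝ᵥ weylEta b

lemma continuous_quotientForm {k : ℕ} (x : Fin k → ℝ) : Continuous (quotientForm x) := by
  have h : Continuous (weylEta : (Fin k → ℝ) → _) := by
    refine continuous_pi fun p => ?_
    unfold weylEta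
    split_ifs <;> fun_prop
  exact (Continuous.matrix_mulVec continuous_const h).dotProduct h

lemma weylGamma_inv_form {k : ℕ} {x : Fin k → ℝ} (hx : Function.Injective x) (b : Fin k → ℝ) :
    ∑ p, (weylGamma x)⁻¹.mulVec (weylEta (nodeMatrix x *ᵥ b)) p *
      weylEta (nodeMatrix x *ᵥ b) p = quotientForm x b := by
  have hW := isUnit_det_hermiteMatrix hx
  change (weylGamma x)⁻¹ *ᵥ weylEta (nodeMatrix x *ᵥ b) ⬝ᵥ weylEta (nodeMatrix x *ᵥ b) = _
  rw [← hermiteMatrix_mulVec_weylEta, weylGamma_eq hx, Matrix.mul_inv_rev, Matrix.mul_inv_rev, mulVec_mulVec,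
    mul_assoc, mul_assoc, nonsing_inv_mul _ hW, mul_one, ← mulVec_mulVec, dotProduct_mulVec,
    ← mulVec_transpose, mulVec_mulVec, mul_nonsing_inv _ (by rwa [det_transpose]), one_mulVec,
    quotientForm]

lemma weylRho_eq {k : ℕ} {x : Fin k → ℝ} (hx : Function.Injective x) :
    weylRho k x = ((2 * Real.pi) ^ k)⁻¹ * (Real.sqrt |(hermiteCov x).det|)⁻¹ *
      (∫ b : Fin k → ℝ, (∏ i, |∑ j, b j * x i ^ (j : ℕ)|) *
        Real.exp (-(1 / 2) * quotientForm x b)) * |(vandermonde x).det| := by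
  have hV : 0 < |(vandermonde x).det| := abs_pos.2 (det_vandermonde_ne_zero hx)
  have hL : (nodeMatrix x).det ≠ 0 := by
    rw [← abs_ne_zero, abs_det_nodeMatrix]
    exact (pow_pos hV 3).ne'
  have hdet : |(weylGamma x).det| = (|(vandermonde x).det| ^ 4) ^ 2 * |(hermiteCov x).det| := by
    rw [weylGamma_eq hx, det_mul, det_mul, det_transpose, abs_mul, abs_mul,
      abs_det_hermiteMatrix]
    ring
  rw [weylRho, hdet, Real.sqrt_mul (by positivity), Real.sqrt_sq (by positivity),
    integral_comp_mulVec hL, abs_det_nodeMatrix]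
  simp only [weylGamma_inv_form hx]
  simp only [nodeMatrix_mulVec, abs_mul, Finset.prod_mul_distrib,
    prod_abs_eval_derivative_nodePoly, mul_assoc, integral_const_mul]
  rw [mul_inv]
  field_simp

end Correlation

/-- **Local estimates for the correlation functions of real zeros of the Weyl series.**
For every `M > 0` and `k ≥ 1` there is `C > 0` (depending only on `M, k`) such that for all
distinct `x_1, …, x_k ∈ [−M, M]`,
`(1/C) ∏_{i<j} |x_i − x_j| ≤ ρ_k(x_1,…,x_k) ≤ C ∏_{i<j} |x_i − x_j|`. -/
theorem weyl_correlation_local_estimate :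
    ∀ M : ℝ, 0 < M → ∀ k : ℕ, 1 ≤ k → ∃ C : ℝ, 0 < C ∧
      ∀ x : Fin k → ℝ, Function.Injective x → (∀ i, x i ∈ Set.Icc (-M) M) →
        (1 / C) * (∏ p ∈ Finset.univ.filter (fun p : Fin k × Fin k => p.1 < p.2),
            |x p.1 - x p.2|) ≤ weylRho k x ∧
        weylRho k x ≤ C * ∏ p ∈ Finset.univ.filter (fun p : Fin k × Fin k => p.1 < p.2),
            |x p.1 - x p.2| := by
  intro M hM k hk
  obtain ⟨c, D, hc, hD, hcov⟩ := hermiteCov_bounds hM.le hk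
  obtain ⟨m, U, hm, hU, hJ⟩ :=
    integral_prod_abs_mul_exp_bounds hk hM.le (inv_pos.2 hD) (inv_pos.2 hc).le
  set N := Fintype.card (Fin k × Fin 2)
  set a : ℝ := ((2 * Real.pi) ^ k)⁻¹ * (Real.sqrt (D ^ N))⁻¹ * m with ha_def
  set A : ℝ := ((2 * Real.pi) ^ k)⁻¹ * (Real.sqrt (c ^ N))⁻¹ * U with hA_def
  have ha : 0 < a := by positivity
  have hA : 0 < A := by positivity
  refine ⟨max a⁻¹ A, lt_max_of_lt_right hA, fun x hx hxM => ?_⟩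
  have hxabs : ∀ i, |x i| ≤ M := fun i => abs_le.2 (hxM i)
  have hform := hcov x hx hxabs
  have hherm := hermiteCov_isHermitian x
  obtain ⟨hdet₁, hdet₂⟩ := det_bounds_of_form_bounds hherm hc hform
  have hdet : 0 < (hermiteCov x).det := (pow_pos hc _).trans_le hdet₁
  obtain ⟨hJ₁, hJ₂⟩ := hJ x hxabs (quotientForm x) (continuous_quotientForm x) fun b => by
    rw [← weylEta_dotProduct_self]
    exact inv_form_bounds_of_form_bounds hherm hc hD hform _
  rw [← vandermonde_prod_eq, weylRho_eq hx, abs_of_pos hdet]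
  constructor
  · refine mul_le_mul_of_nonneg_right ?_ (abs_nonneg _)
    have h1 : 1 / max a⁻¹ A ≤ a := by
      rw [one_div]
      exact inv_le_of_inv_le₀ ha (le_max_left _ _)
    refine h1.trans ?_
    rw [ha_def]
    gcongr
  · refine mul_le_mul_of_nonneg_right (le_trans ?_ (le_max_right _ _)) (abs_nonneg _)
    rw [hA_def]
    gcongr

end
end

section
/- Let ℓ(t) = min(1, |t|) for t ∈ ℝ. For every integer k ≥ 1 there is a finite positive constant C_k (depending only on k) such that for all distinct real numbers x_1, …, x_k, (1/C_k) ∏_{1 ≤ i < j ≤ k} ℓ(|x_i − x_j|) ≤ ρ_k(x_1, …, x_k) ≤ C_k ∏_{1 ≤ i < j ≤ k} ℓ(|x_i − x_j|), where ρ_k is the k-point correlation function of the real zeros of the Weyl series P_∞. -/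
open MeasureTheory ProbabilityTheory Real Filter Topology
open scoped BigOperators Classical

noncomputable section

/-- The character `t ↦ e^{iyt}`. -/
def fourierExp (y t : ℝ) : ℂ := Complex.exp (Complex.I * (y * t))

lemma fourierExp_zero_right (y : ℝ) : fourierExp y 0 = 1 := by simp [fourierExp]

lemma fourierExp_zero_left (t : ℝ) : fourierExp 0 t = 1 := by simp [fourierExp]

lemma fourierExp_add_right (y s t : ℝ) :
    fourierExp y (s + t) = fourierExp y s * fourierExp y t := by
  simp only [fourierExp, ← Complex.exp_add]; push_cast; ring_nf

lemma fourierExp_add_left (y z t : ℝ) :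
    fourierExp (y + z) t = fourierExp y t * fourierExp z t := by
  simp only [fourierExp, ← Complex.exp_add]; push_cast; ring_nf

lemma norm_fourierExp (y t : ℝ) : ‖fourierExp y t‖ = 1 := by
  rw [fourierExp, mul_comm, ← Complex.ofReal_mul, Complex.norm_exp_ofReal_mul_I]

lemma fourierExp_ne_zero (y t : ℝ) : fourierExp y t ≠ 0 := Complex.exp_ne_zero _

lemma hasDerivAt_fourierExp (y t : ℝ) :
    HasDerivAt (fourierExp y) (Complex.I * y * fourierExp y t) t := by
  have h : HasDerivAt (fun t : ℝ => Complex.I * ((y : ℂ) * (t : ℂ))) (Complex.I * y) t := by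
    simpa using (((hasDerivAt_id t).ofReal_comp).const_mul (y : ℂ)).const_mul Complex.I
  have h2 := h.cexp
  rw [mul_comm] at h2
  exact h2

@[fun_prop]
lemma continuous_fourierExp (y : ℝ) : Continuous (fourierExp y) := by
  unfold fourierExp; fun_prop

lemma norm_fourierExp_sub (y z t : ℝ) :
    ‖fourierExp y t - fourierExp z t‖ = 2 * |Real.sin (t * (y - z) / 2)| := by
  have h : fourierExp y t - fourierExp z t = fourierExp z t * (fourierExp (y - z) t - 1) := by
    rw [mul_sub, ← fourierExp_add_left]; simp
  rw [h, norm_mul, norm_fourierExp, one_mul, fourierExp, ← Complex.ofReal_mul,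
    Complex.norm_exp_I_mul_ofReal_sub_one, norm_mul]
  simp [mul_comm]

lemma exists_step_min_le_sin (d : ℝ) :
    ∃ β : ℝ, 0 ≤ β ∧ β ≤ 1 ∧ 2 / π * min 1 |d| ≤ 2 * |Real.sin (β * d / 2)| := by
  have hπ := Real.pi_pos
  have hπ3 := Real.pi_gt_three
  rcases le_total |d| π with h | h
  · refine ⟨1, by norm_num, le_rfl, ?_⟩
    have h1 := Real.mul_abs_le_abs_sin (x := 1 * d / 2) (by
      rw [one_mul, abs_div, abs_two]; linarith)
    rw [one_mul, abs_div, abs_two] at h1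
    rw [one_mul]
    have h2 : 2 / π * min 1 |d| ≤ 2 / π * |d| := by gcongr; exact min_le_right _ _
    nlinarith
  · have hd : 0 < |d| := by linarith
    refine ⟨π / |d|, by positivity, by rw [div_le_one hd]; exact h, ?_⟩
    have h1 : |Real.sin (π / |d| * d / 2)| = 1 := by
      rcases abs_choice d with h' | h'
      · rw [h']
        have : d ≠ 0 := by rintro rfl; simp at hd
        rw [div_mul_cancel₀ _ this]; simp
      · rw [h']
        have : d ≠ 0 := by rintro rfl; simp at hd
        rw [show π / -d * d / 2 = -(π / 2) by field_simp]; simp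
    rw [h1]
    have : 2 / π ≤ 1 := by rw [div_le_one hπ]; linarith
    have h3 : min 1 |d| ≤ 1 := min_le_left _ _
    have h4 : 0 ≤ min 1 |d| := by positivity
    nlinarith

lemma integral_norm_sq_shift_sub_le {F : ℝ → ℂ} (hF : Continuous F) {β N : ℝ} (h0 : 0 ≤ β)
    (h1 : β ≤ 1) (hN : 0 ≤ N) {w : ℂ} (hw : ‖w‖ = 1) :
    ∫ t in (0 : ℝ)..N, ‖F (t + β) - w * F t‖ ^ 2 ≤ 4 * ∫ t in (0 : ℝ)..(N + 1), ‖F t‖ ^ 2 := by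
  have hc : Continuous fun t => ‖F t‖ ^ 2 := by fun_prop
  have step : ∫ t in (0 : ℝ)..N, ‖F (t + β) - w * F t‖ ^ 2 ≤
      ∫ t in (0 : ℝ)..N, (2 * ‖F (t + β)‖ ^ 2 + 2 * ‖F t‖ ^ 2) := by
    apply intervalIntegral.integral_mono_on hN
    · exact Continuous.intervalIntegrable (by fun_prop) _ _
    · exact Continuous.intervalIntegrable (by fun_prop) _ _
    · intro t _
      have := norm_sub_le (F (t + β)) (w * F t)
      rw [norm_mul, hw, one_mul] at this
      nlinarith [sq_nonneg (‖F (t + β)‖ - ‖F t‖), norm_nonneg (F (t + β) - w * F t),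
        norm_nonneg (F (t + β)), norm_nonneg (F t)]
  have i1 : ∫ t in (0 : ℝ)..N, ‖F (t + β)‖ ^ 2 ≤ ∫ t in (0 : ℝ)..(N + 1), ‖F t‖ ^ 2 := by
    rw [intervalIntegral.integral_comp_add_right (fun t => ‖F t‖ ^ 2)]
    refine intervalIntegral.integral_mono_interval (by linarith) (by linarith) (by linarith)
      (Eventually.of_forall fun t => by positivity) (hc.intervalIntegrable _ _)
  have i2 : ∫ t in (0 : ℝ)..N, ‖F t‖ ^ 2 ≤ ∫ t in (0 : ℝ)..(N + 1), ‖F t‖ ^ 2 :=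
    intervalIntegral.integral_mono_interval le_rfl hN (by linarith)
      (Eventually.of_forall fun t => by positivity) (hc.intervalIntegrable _ _)
  rw [intervalIntegral.integral_add (Continuous.intervalIntegrable (by fun_prop) _ _)
    (Continuous.intervalIntegrable (by fun_prop) _ _), intervalIntegral.integral_const_mul,
    intervalIntegral.integral_const_mul] at step
  linarith

/-- An exponential sum is bounded below in `L²` of a bounded interval by its leading coefficient
times the product of the truncated distances of the leading frequency to the other ones. -/
lemma le_integral_norm_sq_exponential_sum {ι : Type*} (y : ι → ℝ) (y₀ : ℝ) (s : Finset ι) :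
    ∀ (c₀ : ℂ) (c : ι → ℂ), ‖c₀‖ ^ 2 * ∏ j ∈ s, (min 1 |y₀ - y j|) ^ 2 ≤
      (π ^ 2) ^ s.card * ∫ t in (0 : ℝ)..(s.card + 1),
        ‖c₀ * fourierExp y₀ t + ∑ j ∈ s, c j * fourierExp (y j) t‖ ^ 2 := by
  induction s using Finset.induction_on with
  | empty => intro c₀ c; simp [norm_fourierExp]
  | insert a s ha ih =>
    intro c₀ c
    obtain ⟨β, hβ0, hβ1, hβ⟩ := exists_step_min_le_sin (y₀ - y a)
    set F : ℝ → ℂ := fun t =>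
      c₀ * fourierExp y₀ t + ∑ j ∈ insert a s, c j * fourierExp (y j) t with hF
    have hFc : Continuous F := by rw [hF]; fun_prop
    have key : ∀ t, F (t + β) - fourierExp (y a) β * F t =
        (c₀ * (fourierExp y₀ β - fourierExp (y a) β)) * fourierExp y₀ t +
          ∑ j ∈ s, (c j * (fourierExp (y j) β - fourierExp (y a) β)) * fourierExp (y j) t := by
      intro t
      simp only [hF, Finset.sum_insert ha, fourierExp_add_right, mul_add, Finset.mul_sum]
      have : ∑ j ∈ s, (c j * (fourierExp (y j) β - fourierExp (y a) β)) * fourierExp (y j) t =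
          ∑ j ∈ s, c j * (fourierExp (y j) t * fourierExp (y j) β) -
            ∑ j ∈ s, fourierExp (y a) β * (c j * fourierExp (y j) t) := by
        rw [← Finset.sum_sub_distrib]
        exact Finset.sum_congr rfl fun j _ => by ring
      rw [this]; ring
    have h1 := ih (c₀ * (fourierExp y₀ β - fourierExp (y a) β))
      (fun j => c j * (fourierExp (y j) β - fourierExp (y a) β))
    have h2 := integral_norm_sq_shift_sub_le hFc hβ0 hβ1 (N := s.card + 1) (by positivity)
      (norm_fourierExp (y a) β)
    simp only [key] at h2
    rw [Finset.prod_insert ha, Finset.card_insert_of_notMem ha, pow_succ]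
    push_cast
    rw [norm_mul, norm_fourierExp_sub, mul_pow] at h1
    have hπ := Real.pi_pos
    have h3 : (2 / π * min 1 |y₀ - y a|) ^ 2 ≤ (2 * |Real.sin (β * (y₀ - y a) / 2)|) ^ 2 := by
      gcongr
    have hP : 0 ≤ ∏ j ∈ s, (min 1 |y₀ - y j|) ^ 2 := Finset.prod_nonneg fun j _ => by positivity
    calc ‖c₀‖ ^ 2 * (min 1 |y₀ - y a| ^ 2 * ∏ j ∈ s, min 1 |y₀ - y j| ^ 2)
        = π ^ 2 / 4 * (‖c₀‖ ^ 2 * (2 / π * min 1 |y₀ - y a|) ^ 2 *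
            ∏ j ∈ s, min 1 |y₀ - y j| ^ 2) := by field_simp; ring
      _ ≤ π ^ 2 / 4 * (‖c₀‖ ^ 2 * (2 * |Real.sin (β * (y₀ - y a) / 2)|) ^ 2 *
            ∏ j ∈ s, min 1 |y₀ - y j| ^ 2) := by gcongr
      _ ≤ π ^ 2 / 4 * ((π ^ 2) ^ s.card * (4 * ∫ t in (0 : ℝ)..(s.card + 1 + 1), ‖F t‖ ^ 2)) := by
          exact mul_le_mul_of_nonneg_left (h1.trans (by gcongr)) (by positivity)
      _ = _ := by ring

/-- The analogue of `le_integral_norm_sq_exponential_sum` when the leading term is `t e^{iyt}`. -/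
lemma le_integral_norm_sq_exponential_sum_deriv {ι : Type*} (y : ι → ℝ) (y₀ : ℝ) (s : Finset ι)
    (c₀ c₁ : ℂ) (c : ι → ℂ) : ‖c₁‖ ^ 2 * ∏ j ∈ s, (min 1 |y₀ - y j|) ^ 2 ≤
      4 * (π ^ 2) ^ s.card * ∫ t in (0 : ℝ)..(s.card + 2),
        ‖(c₀ + c₁ * t) * fourierExp y₀ t + ∑ j ∈ s, c j * fourierExp (y j) t‖ ^ 2 := by
  set F : ℝ → ℂ := fun t =>
    (c₀ + c₁ * t) * fourierExp y₀ t + ∑ j ∈ s, c j * fourierExp (y j) t with hF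
  have hFc : Continuous F := by rw [hF]; fun_prop
  have key : ∀ t, F (t + 1) - fourierExp y₀ 1 * F t =
      (c₁ * fourierExp y₀ 1) * fourierExp y₀ t +
        ∑ j ∈ s, (c j * (fourierExp (y j) 1 - fourierExp y₀ 1)) * fourierExp (y j) t := by
    intro t
    simp only [hF, fourierExp_add_right, mul_add, Finset.mul_sum]
    have : ∑ j ∈ s, (c j * (fourierExp (y j) 1 - fourierExp y₀ 1)) * fourierExp (y j) t =
        ∑ j ∈ s, c j * (fourierExp (y j) t * fourierExp (y j) 1) -
          ∑ j ∈ s, fourierExp y₀ 1 * (c j * fourierExp (y j) t) := by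
      rw [← Finset.sum_sub_distrib]
      exact Finset.sum_congr rfl fun j _ => by ring
    rw [this]; push_cast; ring
  have h1 := le_integral_norm_sq_exponential_sum y y₀ s (c₁ * fourierExp y₀ 1)
    (fun j => c j * (fourierExp (y j) 1 - fourierExp y₀ 1))
  have h2 := integral_norm_sq_shift_sub_le hFc zero_le_one le_rfl (N := s.card + 1) (by positivity)
    (norm_fourierExp y₀ 1)
  simp only [key] at h2
  rw [norm_mul, norm_fourierExp, mul_one] at h1
  refine h1.trans ?_
  rw [show (s.card : ℝ) + 2 = s.card + 1 + 1 by ring]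
  calc _ ≤ (π ^ 2) ^ s.card * (4 * ∫ t in (0 : ℝ)..(s.card + 1 + 1), ‖F t‖ ^ 2) := by gcongr
    _ = _ := by ring

lemma norm_le_of_hasDerivAt_of_norm_le_pow {G G' : ℝ → ℂ} (hG : ∀ t, HasDerivAt G (G' t) t)
    (h0 : G 0 = 0) {C : ℝ} {m : ℕ} (hC : 0 ≤ C) (hb : ∀ t, ‖G' t‖ ≤ |t| ^ m * C) (t : ℝ) :
    ‖G t‖ ≤ |t| ^ (m + 1) * C := by
  have h := Convex.norm_image_sub_le_of_norm_hasDerivWithin_le (f := G) (f' := G')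
    (s := Set.Icc (-|t|) |t|) (x := 0) (y := t) (C := |t| ^ m * C)
    (fun u _ => (hG u).hasDerivWithinAt)
    (fun u hu => (hb u).trans (by have := abs_le.2 hu; gcongr)) (convex_Icc _ _)
    (by simp) ⟨neg_abs_le t, le_abs_self t⟩
  rw [h0, sub_zero, sub_zero, Real.norm_eq_abs] at h
  calc ‖G t‖ ≤ _ := h
    _ = _ := by ring

/-- There is an exponential sum with leading coefficient `1` which vanishes at the origin
to the order given by the number of other frequencies, with an explicit bound. -/
lemma exists_exponential_sum_norm_le {ι : Type*} (y : ι → ℝ) (y₀ : ℝ) (s : Finset ι)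
    (hinj : Set.InjOn y s) (hy : ∀ j ∈ s, y j ≠ y₀) :
    ∃ c : ι → ℝ, ∀ t : ℝ, ‖fourierExp y₀ t + ∑ j ∈ s, c j * fourierExp (y j) t‖ ≤
      |t| ^ s.card * ∏ j ∈ s, |y₀ - y j| := by
  induction s using Finset.induction_on with
  | empty => exact ⟨0, fun t => by simp [norm_fourierExp]⟩
  | insert a s ha ih =>
    obtain ⟨c, hc⟩ := ih (hinj.mono (by simp)) (fun j hj => hy j (by simp [hj]))
    have hya : ∀ j ∈ s, y j - y a ≠ 0 := fun j hj h => by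
      have := hinj (by simp [hj]) (by simp) (sub_eq_zero.1 h)
      exact ha (this ▸ hj)
    set d := y₀ - y a with hd
    let c' : ι → ℝ := fun j => c j * d / (y j - y a)
    let G : ℝ → ℂ := fun t => fourierExp d t + ∑ j ∈ s, c' j * fourierExp (y j - y a) t
      - (1 + ∑ j ∈ s, (c' j : ℂ))
    have hG : ∀ t, HasDerivAt G (Complex.I * d * fourierExp (-y a) t *
        (fourierExp y₀ t + ∑ j ∈ s, c j * fourierExp (y j) t)) t := by
      intro t
      have h := ((hasDerivAt_fourierExp d t).add (HasDerivAt.fun_sum (u := s) fun j _ =>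
        (hasDerivAt_fourierExp (y j - y a) t).const_mul (c' j : ℂ))).sub_const
          (1 + ∑ j ∈ s, (c' j : ℂ))
      refine HasDerivAt.congr_deriv (f := G) h ?_
      rw [mul_add, Finset.mul_sum]
      congr 1
      · rw [hd, sub_eq_add_neg, fourierExp_add_left]; ring
      · refine Finset.sum_congr rfl fun j hj => ?_
        have h1 : ((y j : ℂ) - y a) ≠ 0 := by exact_mod_cast hya j hj
        rw [sub_eq_add_neg (y j), fourierExp_add_left]
        simp only [c']
        push_cast
        rw [← sub_eq_add_neg]
        field_simp
    have hG0 : G 0 = 0 := by simp [G, fourierExp_zero_right]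
    have hb := norm_le_of_hasDerivAt_of_norm_le_pow hG hG0 (C := |d| * ∏ j ∈ s, |y₀ - y j|)
      (m := s.card) (by positivity) (fun t => by
        rw [norm_mul, norm_mul, norm_mul, norm_fourierExp, Complex.norm_I, Complex.norm_real,
          Real.norm_eq_abs, one_mul, mul_one]
        calc _ ≤ |d| * (|t| ^ s.card * ∏ j ∈ s, |y₀ - y j|) := by gcongr; exact hc t
          _ = _ := by ring)
    refine ⟨fun j => if j = a then -(1 + ∑ j ∈ s, c' j) else c' j, fun t => ?_⟩
    rw [Finset.prod_insert ha, Finset.card_insert_of_notMem ha]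
    refine le_of_eq_of_le ?_ (hb t)
    have hn : ‖G t‖ = ‖fourierExp (y a) t * G t‖ := by rw [norm_mul, norm_fourierExp, one_mul]
    rw [hn]
    congr 1
    rw [Finset.sum_insert ha]
    have : ∑ j ∈ s, (((if j = a then -(1 + ∑ j ∈ s, c' j) else c' j : ℝ)) : ℂ) *
          fourierExp (y j) t =
        ∑ j ∈ s, (c' j : ℂ) * (fourierExp (y a) t * fourierExp (y j - y a) t) := by
      refine Finset.sum_congr rfl fun j hj => ?_
      rw [if_neg (by rintro rfl; exact ha hj), ← fourierExp_add_left]; simp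
    rw [this, show fourierExp y₀ t = fourierExp (y a) t * fourierExp d t by
      rw [← fourierExp_add_left]; simp [hd]]
    simp only [if_true, G, mul_sub, mul_add, Finset.mul_sum]
    push_cast
    have : ∑ j ∈ s, (c' j : ℂ) * (fourierExp (y a) t * fourierExp (y j - y a) t) =
      ∑ j ∈ s, fourierExp (y a) t * ((c' j : ℂ) * fourierExp (y j - y a) t) :=
      Finset.sum_congr rfl fun j _ => by ring
    rw [this, ← Finset.mul_sum, ← Finset.mul_sum]
    ring

/-- The analogue of `exists_exponential_sum_norm_le` when the leading term is `i t e^{iyt}`. -/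
lemma exists_exponential_sum_deriv_norm_le {ι : Type*} (y : ι → ℝ) (y₀ : ℝ) (s : Finset ι)
    (hinj : Set.InjOn y s) (hy : ∀ j ∈ s, y j ≠ y₀) :
    ∃ (c₀ : ℝ) (c : ι → ℝ), ∀ t : ℝ,
      ‖(c₀ + Complex.I * t) * fourierExp y₀ t + ∑ j ∈ s, c j * fourierExp (y j) t‖ ≤
        |t| ^ (s.card + 1) * ∏ j ∈ s, |y₀ - y j| := by
  obtain ⟨c, hc⟩ := exists_exponential_sum_norm_le y y₀ s hinj hy
  have hya : ∀ j ∈ s, y j - y₀ ≠ 0 := fun j hj h => hy j hj (sub_eq_zero.1 h)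
  let c' : ι → ℝ := fun j => c j / (y j - y₀)
  let G : ℝ → ℂ := fun t => Complex.I * t + ∑ j ∈ s, c' j * fourierExp (y j - y₀) t
    - ∑ j ∈ s, (c' j : ℂ)
  have hG : ∀ t, HasDerivAt G (Complex.I * fourierExp (-y₀) t *
      (fourierExp y₀ t + ∑ j ∈ s, c j * fourierExp (y j) t)) t := by
    intro t
    have h := ((((hasDerivAt_id t).ofReal_comp).const_mul Complex.I).add
      (HasDerivAt.fun_sum (u := s) fun j _ =>
        (hasDerivAt_fourierExp (y j - y₀) t).const_mul (c' j : ℂ))).sub_const (∑ j ∈ s, (c' j : ℂ))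
    refine HasDerivAt.congr_deriv (f := G) h ?_
    rw [mul_add, Finset.mul_sum]
    congr 1
    · rw [mul_assoc, ← fourierExp_add_left]; simp [fourierExp_zero_left]
    · refine Finset.sum_congr rfl fun j hj => ?_
      have h1 : ((y j : ℂ) - y₀) ≠ 0 := by exact_mod_cast hya j hj
      rw [sub_eq_add_neg (y j), fourierExp_add_left]
      simp only [c']
      push_cast
      rw [← sub_eq_add_neg]
      field_simp
  have hG0 : G 0 = 0 := by simp [G, fourierExp_zero_right]
  have hb := norm_le_of_hasDerivAt_of_norm_le_pow hG hG0 (C := ∏ j ∈ s, |y₀ - y j|)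
    (m := s.card) (by positivity) (fun t => by
      rw [norm_mul, norm_mul, norm_fourierExp, Complex.norm_I, one_mul, one_mul]
      exact hc t)
  refine ⟨-∑ j ∈ s, c' j, c', fun t => le_of_eq_of_le ?_ (hb t)⟩
  have hn : ‖G t‖ = ‖fourierExp y₀ t * G t‖ := by rw [norm_mul, norm_fourierExp, one_mul]
  rw [hn]
  congr 1
  have : ∑ j ∈ s, (c' j : ℂ) * fourierExp (y j) t =
      ∑ j ∈ s, fourierExp y₀ t * ((c' j : ℂ) * fourierExp (y j - y₀) t) := by
    refine Finset.sum_congr rfl fun j _ => ?_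
    rw [mul_left_comm, ← fourierExp_add_left]; simp
  rw [this, ← Finset.mul_sum]
  simp only [G]
  push_cast
  ring

/-- The functions `t ↦ (a + b t) e^{iyt}` for distinct frequencies `y` are independent. -/
lemma coeff_eq_zero_of_sum_eq_zero {ι : Type*} (y : ι → ℝ) (s : Finset ι)
    (hinj : Set.InjOn y s) : ∀ a b : ι → ℂ,
    (∀ t : ℝ, ∑ j ∈ s, (a j + b j * t) * fourierExp (y j) t = 0) → ∀ j ∈ s, a j = 0 ∧ b j = 0 := by
  induction s using Finset.induction_on with
  | empty => simp
  | insert i s hi ih =>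
    intro a b h
    have hs : ∀ j ∈ s, a j = 0 ∧ b j = 0 := by
      intro j hj
      have hne : min 1 |y j - y i| > 0 := by
        refine lt_min one_pos (abs_pos.2 (sub_ne_zero.2 fun h => ?_))
        exact hi (hinj (by simp [hj]) (by simp) h ▸ hj)
      obtain ⟨β, -, -, hβ⟩ := exists_step_min_le_sin (y j - y i)
      rw [← norm_fourierExp_sub] at hβ
      have hw : fourierExp (y j) β - fourierExp (y i) β ≠ 0 := by
        rw [← norm_pos_iff]
        exact lt_of_lt_of_le (by have := Real.pi_pos; positivity) hβ
      set w := fun k => fourierExp (y k) β with hwdef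
      have key := ih (hinj.mono (by simp))
        (fun k => (w k - w i) * (a k * (w k - w i) + 2 * b k * β * w k))
        (fun k => b k * (w k - w i) ^ 2) (fun t => ?_) j hj
      · obtain ⟨h1, h2⟩ := key
        have hb : b j = 0 := by simpa [hw, hwdef] using h2
        refine ⟨?_, hb⟩
        simpa [hb, hw, hwdef] using h1
      · have e0 := h t
        have e1 := h (t + β)
        have e2 := h (t + β + β)
        have e : ∑ k ∈ insert i s, (((a k + b k * (t + β + β : ℝ)) * fourierExp (y k) (t + β + β)) -
          2 * w i * ((a k + b k * (t + β : ℝ)) * fourierExp (y k) (t + β)) +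
            w i ^ 2 * ((a k + b k * t) * fourierExp (y k) t)) = 0 := by
          rw [Finset.sum_add_distrib, Finset.sum_sub_distrib, ← Finset.mul_sum, ← Finset.mul_sum,
            e0, e1, e2]
          simp
        rw [Finset.sum_insert hi] at e
        have hi0 : (a i + b i * (t + β + β : ℝ)) * fourierExp (y i) (t + β + β) -
            2 * w i * ((a i + b i * (t + β : ℝ)) * fourierExp (y i) (t + β)) +
            w i ^ 2 * ((a i + b i * t) * fourierExp (y i) t) = 0 := by
          simp only [fourierExp_add_right, hwdef]
          push_cast
          ring
        rw [hi0, zero_add] at e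
        rw [← e]
        refine Finset.sum_congr rfl fun k _ => ?_
        simp only [fourierExp_add_right, hwdef]
        push_cast
        ring
    refine fun j hj => ?_
    rcases Finset.mem_insert.1 hj with rfl | hj
    · have h' : ∀ t : ℝ, a j + b j * t = 0 := by
        intro t
        have := h t
        rw [Finset.sum_insert hi, Finset.sum_eq_zero (fun k hk => by simp [hs k hk]), add_zero]
          at this
        exact (mul_eq_zero.1 this).resolve_right (fourierExp_ne_zero _ _)
      have ha : a j = 0 := by simpa using h' 0
      refine ⟨ha, by simpa [ha] using h' 1⟩
    · exact hs j hj

lemma integrable_one_add_abs_pow_gaussianReal (n : ℕ) :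
    Integrable (fun u : ℝ => (1 + |u|) ^ n) (gaussianReal 0 1) := by
  have h : MemLp (fun u : ℝ => 1 + |u|) n (gaussianReal 0 1) := by
    have h1 : MemLp (fun u : ℝ => |u|) n (gaussianReal 0 1) :=
      (memLp_id_gaussianReal (μ := 0) (v := 1) n).norm
    exact (memLp_const (1 : ℝ)).add h1
  refine h.integrable_norm_pow'.congr (Eventually.of_forall fun u => ?_)
  simp only [Real.norm_eq_abs]
  rw [abs_of_nonneg (by positivity)]

lemma integral_gaussianReal_cexp (z : ℂ) :
    ∫ u : ℝ, Complex.exp (z * u) ∂(gaussianReal 0 1) = Complex.exp (z ^ 2 / 2) := by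
  have h := complexMGF_id_gaussianReal (μ := 0) (v := 1) z
  simpa [complexMGF] using h

lemma hasDerivAt_integral_gaussianReal_pow_mul_cexp (z : ℂ) (n : ℕ) :
    HasDerivAt (fun z : ℂ => ∫ u : ℝ, (u : ℂ) ^ n * Complex.exp (z * u) ∂(gaussianReal 0 1))
      (∫ u : ℝ, (u : ℂ) ^ (n + 1) * Complex.exp (z * u) ∂(gaussianReal 0 1)) z :=
  hasDerivAt_integral_pow_mul_exp (X := id) (by simp [integrableExpSet_id_gaussianReal]) n

lemma integral_gaussianReal_mul_cexp (z : ℂ) :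
    ∫ u : ℝ, (u : ℂ) * Complex.exp (z * u) ∂(gaussianReal 0 1) = z * Complex.exp (z ^ 2 / 2) := by
  have h := hasDerivAt_integral_gaussianReal_pow_mul_cexp z 0
  simp only [pow_zero, one_mul, zero_add, pow_one, integral_gaussianReal_cexp] at h
  refine h.unique ?_
  have h2 : HasDerivAt (fun z : ℂ => z ^ 2 / 2) z z := by
    have := (hasDerivAt_pow 2 z).div_const 2
    simpa using this
  simpa [mul_comm] using h2.cexp

lemma integral_gaussianReal_sq_mul_cexp (z : ℂ) :
    ∫ u : ℝ, (u : ℂ) ^ 2 * Complex.exp (z * u) ∂(gaussianReal 0 1) =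
      (1 + z ^ 2) * Complex.exp (z ^ 2 / 2) := by
  have h := hasDerivAt_integral_gaussianReal_pow_mul_cexp z 1
  simp only [pow_one, one_add_one_eq_two, integral_gaussianReal_mul_cexp] at h
  refine h.unique ?_
  have h2 : HasDerivAt (fun z : ℂ => z ^ 2 / 2) z z := by
    have := (hasDerivAt_pow 2 z).div_const 2
    simpa using this
  refine ((hasDerivAt_id z).mul h2.cexp).congr_deriv ?_
  simp only [id]
  ring

/-- The functions representing the jet of the Weyl series in `L²` of the standard Gaussian
measure: their Gram matrix is `weylCov`. -/
def weylFeature (s : ℝ) (a : Fin 2) (u : ℝ) : ℂ :=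
  Real.exp (s ^ 2 / 2) * ((if a = 0 then 1 else s + Complex.I * u) * fourierExp s u)

@[fun_prop]
lemma continuous_weylFeature (s : ℝ) (a : Fin 2) : Continuous (weylFeature s a) := by
  unfold weylFeature
  split_ifs <;> fun_prop

lemma norm_weylFeature_le (s : ℝ) (a : Fin 2) (u : ℝ) :
    ‖weylFeature s a u‖ ≤ Real.exp (s ^ 2 / 2) * (1 + |s|) * (1 + |u|) := by
  rw [weylFeature, norm_mul, norm_mul, norm_fourierExp, mul_one, Complex.norm_real,
    Real.norm_of_nonneg (Real.exp_pos _).le, mul_assoc]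
  gcongr
  split_ifs
  · simp only [norm_one]
    nlinarith [abs_nonneg s, abs_nonneg u]
  · refine (norm_add_le _ _).trans ?_
    rw [norm_mul, Complex.norm_I, Complex.norm_real, Complex.norm_real, Real.norm_eq_abs,
      Real.norm_eq_abs]
    nlinarith [abs_nonneg s, abs_nonneg u]

lemma integrable_of_continuous_of_norm_le {E : Type*} [NormedAddCommGroup E]
    [SecondCountableTopology E] {f : ℝ → E} (hf : Continuous f) (C : ℝ) (n : ℕ)
    (h : ∀ u, ‖f u‖ ≤ C * (1 + |u|) ^ n) : Integrable f (gaussianReal 0 1) :=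
  ((integrable_one_add_abs_pow_gaussianReal n).const_mul C).mono' hf.aestronglyMeasurable
    (Eventually.of_forall h)

lemma integrable_weylFeature_mul (s t : ℝ) (a b : Fin 2) :
    Integrable (fun u => weylFeature s a u * (starRingEnd ℂ) (weylFeature t b u))
      (gaussianReal 0 1) := by
  refine integrable_of_continuous_of_norm_le (by fun_prop)
    ((Real.exp (s ^ 2 / 2) * (1 + |s|)) * (Real.exp (t ^ 2 / 2) * (1 + |t|))) 2 fun u => ?_
  rw [norm_mul, RCLike.norm_conj]
  calc _ ≤ (Real.exp (s ^ 2 / 2) * (1 + |s|) * (1 + |u|)) *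
        (Real.exp (t ^ 2 / 2) * (1 + |t|) * (1 + |u|)) := by
        gcongr <;> exact norm_weylFeature_le _ _ _
    _ = _ := by ring

lemma integrable_pow_mul_cexp_I (d : ℝ) (n : ℕ) :
    Integrable (fun u : ℝ => (u : ℂ) ^ n * Complex.exp (Complex.I * d * u))
      (gaussianReal 0 1) := by
  refine integrable_of_continuous_of_norm_le (by fun_prop) 1 n fun u => ?_
  rw [norm_mul, show Complex.I * (d : ℂ) * u = ((d * u : ℝ) : ℂ) * Complex.I by push_cast; ring,
    Complex.norm_exp_ofReal_mul_I, norm_pow, Complex.norm_real, Real.norm_eq_abs]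
  have : |u| ^ n ≤ (1 + |u|) ^ n := by gcongr; linarith
  linarith

lemma integral_weylFeature_mul (s t : ℝ) (a b : Fin 2) :
    ∫ u, weylFeature s a u * (starRingEnd ℂ) (weylFeature t b u) ∂(gaussianReal 0 1) =
      weylCov s t a b := by
  set α : ℂ := if a = 0 then 1 else s with hα
  set α' : ℂ := if a = 0 then 0 else Complex.I with hα'
  set β : ℂ := if b = 0 then 1 else t with hβ
  set β' : ℂ := if b = 0 then 0 else -Complex.I with hβ'
  set z : ℂ := Complex.I * ((s - t : ℝ) : ℂ) with hz
  have h : ∀ u : ℝ, weylFeature s a u * (starRingEnd ℂ) (weylFeature t b u) =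
      Complex.exp ((s ^ 2 + t ^ 2) / 2) * (α * β * ((u : ℂ) ^ 0 * Complex.exp (z * u)) +
        (α * β' + α' * β) * ((u : ℂ) ^ 1 * Complex.exp (z * u)) +
        α' * β' * ((u : ℂ) ^ 2 * Complex.exp (z * u))) := by
    intro u
    have e1 : weylFeature s a u = Complex.exp (s ^ 2 / 2) * ((α + α' * u) * fourierExp s u) := by
      rw [weylFeature, hα, hα']; split_ifs <;> simp
    have e2 : (starRingEnd ℂ) (weylFeature t b u) =
        Complex.exp (t ^ 2 / 2) * ((β + β' * u) * fourierExp (-t) u) := by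
      rw [weylFeature, hβ, hβ', map_mul, map_mul]
      have : (starRingEnd ℂ) (fourierExp t u) = fourierExp (-t) u := by
        simp [fourierExp, ← Complex.exp_conj]
      rw [this, Complex.conj_ofReal]
      split_ifs <;> simp
    have e3 : Complex.exp (z * u) = fourierExp s u * fourierExp (-t) u := by
      rw [← fourierExp_add_left, fourierExp, hz]; congr 1; push_cast; ring
    have e4 : Complex.exp (((s : ℂ) ^ 2 + t ^ 2) / 2) =
        Complex.exp (s ^ 2 / 2) * Complex.exp (t ^ 2 / 2) := by
      rw [← Complex.exp_add]; congr 1; ring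
    rw [e1, e2, e3, e4]; ring
  have i0 := integrable_pow_mul_cexp_I (s - t) 0
  have i1 := integrable_pow_mul_cexp_I (s - t) 1
  have i2 := integrable_pow_mul_cexp_I (s - t) 2
  rw [← hz] at i0 i1 i2
  simp only [h]
  have i01 : Integrable (fun u : ℝ => α * β * ((u : ℂ) ^ 0 * Complex.exp (z * u)) +
      (α * β' + α' * β) * ((u : ℂ) ^ 1 * Complex.exp (z * u))) (gaussianReal 0 1) :=
    (i0.const_mul _).add (i1.const_mul _)
  rw [integral_const_mul, integral_add i01 (i2.const_mul _),
    integral_add (i0.const_mul _) (i1.const_mul _), integral_const_mul, integral_const_mul,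
    integral_const_mul]
  simp only [pow_zero, one_mul, pow_one, integral_gaussianReal_cexp,
    integral_gaussianReal_mul_cexp, integral_gaussianReal_sq_mul_cexp]
  have e : Complex.exp (s * t) =
      Complex.exp (((s : ℂ) ^ 2 + t ^ 2) / 2) * Complex.exp (z ^ 2 / 2) := by
    rw [← Complex.exp_add, hz]; congr 1
    rw [mul_pow, Complex.I_sq]; push_cast; ring
  rw [weylCov]
  have hI := Complex.I_sq
  push_cast
  rw [e]
  generalize Complex.exp (((s : ℂ) ^ 2 + t ^ 2) / 2) = E1
  generalize Complex.exp (z ^ 2 / 2) = E2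
  fin_cases a <;> fin_cases b <;> simp [hα, hα', hβ, hβ', hz] <;> ring_nf <;> simp

/-- The quadratic form of the jet covariance as an `L²` norm. -/
lemma sum_mul_weylCov_mul {κ : Type*} [Fintype κ] (x : κ → ℝ) (a : κ → Fin 2) (v : κ → ℝ) :
    ∑ p, ∑ q, v p * weylCov (x p) (x q) (a p) (a q) * v q =
      ∫ u, ‖∑ p, (v p : ℂ) * weylFeature (x p) (a p) u‖ ^ 2 ∂(gaussianReal 0 1) := by
  have h : ∀ u, ((‖∑ p, (v p : ℂ) * weylFeature (x p) (a p) u‖ ^ 2 : ℝ) : ℂ) =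
      ∑ p, ∑ q, (v p * v q : ℂ) *
        (weylFeature (x p) (a p) u * (starRingEnd ℂ) (weylFeature (x q) (a q) u)) := by
    intro u
    push_cast
    rw [← Complex.mul_conj', map_sum, Finset.sum_mul_sum]
    refine Finset.sum_congr rfl fun p _ => Finset.sum_congr rfl fun q _ => ?_
    rw [map_mul, Complex.conj_ofReal]; ring
  rw [← Complex.ofReal_inj, ← integral_complex_ofReal]
  simp only [h]
  rw [integral_finsetSum _ fun p _ => integrable_finsetSum _ fun q _ =>
    (integrable_weylFeature_mul _ _ _ _).const_mul _]
  push_cast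
  refine Finset.sum_congr rfl fun p _ => ?_
  rw [integral_finsetSum _ fun q _ => (integrable_weylFeature_mul _ _ _ _).const_mul _]
  refine Finset.sum_congr rfl fun q _ => ?_
  rw [integral_const_mul, integral_weylFeature_mul]
  ring

lemma integrable_norm_sq_sum_weylFeature {κ : Type*} [Fintype κ] (x : κ → ℝ) (a : κ → Fin 2)
    (v : κ → ℝ) : Integrable (fun u => ‖∑ p, (v p : ℂ) * weylFeature (x p) (a p) u‖ ^ 2)
      (gaussianReal 0 1) := by
  set C := ∑ p, |v p| * (Real.exp (x p ^ 2 / 2) * (1 + |x p|))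
  refine integrable_of_continuous_of_norm_le (by fun_prop) (C ^ 2) 2 fun u => ?_
  rw [norm_pow, norm_norm, ← mul_pow]
  gcongr
  refine (norm_sum_le _ _).trans ?_
  rw [Finset.sum_mul]
  refine Finset.sum_le_sum fun p _ => ?_
  rw [norm_mul, Complex.norm_real, Real.norm_eq_abs, mul_assoc]
  gcongr
  exact norm_weylFeature_le _ _ _

/-- The standard Gaussian measure dominates Lebesgue measure on bounded intervals. -/
lemma intervalIntegral_le_mul_integral_gaussianReal {f : ℝ → ℝ} {N : ℝ} (hN : 0 ≤ N)
    (hf : ∀ u, 0 ≤ f u) (hfc : Continuous f) (hi : Integrable f (gaussianReal 0 1)) :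
    ∫ u in (0 : ℝ)..N, f u ≤
      Real.sqrt (2 * π) * Real.exp (N ^ 2 / 2) * ∫ u, f u ∂(gaussianReal 0 1) := by
  rw [integral_gaussianReal_eq_integral_smul one_ne_zero, ← integral_const_mul,
    intervalIntegral.integral_of_le hN]
  have hi' : Integrable (fun u => gaussianPDFReal 0 1 u • f u) := by
    rw [gaussianReal_of_var_ne_zero _ one_ne_zero] at hi
    rw [integrable_withDensity_iff_integrable_smul' (measurable_gaussianPDF 0 1)
      (Eventually.of_forall fun _ => gaussianPDF_lt_top)] at hi
    simpa [gaussianPDF, ENNReal.toReal_ofReal, gaussianPDFReal_nonneg] using hi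
  refine le_trans ?_ (setIntegral_le_integral (s := Set.Ioc 0 N) (hi'.const_mul _)
    (Eventually.of_forall fun u => ?_))
  · refine setIntegral_mono_on ?_ (hi'.const_mul _).integrableOn measurableSet_Ioc fun u hu => ?_
    · exact (hfc.integrableOn_Icc).mono_set Set.Ioc_subset_Icc_self
    · rw [smul_eq_mul, ← mul_assoc]
      refine le_mul_of_one_le_left (hf u) ?_
      rw [gaussianPDFReal]
      simp only [NNReal.coe_one, mul_one, sub_zero]
      rw [mul_assoc, mul_left_comm _ _ (Real.exp _), ← mul_assoc, mul_inv_cancel₀ (by positivity),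
        one_mul, ← Real.exp_add]
      refine Real.one_le_exp ?_
      nlinarith [hu.1, hu.2]
  · exact mul_nonneg (by positivity) (mul_nonneg (gaussianPDFReal_nonneg _ _ _) (hf u))

lemma exists_pos_forall_le_nat (f : ℕ → ℝ) (hf : ∀ n, 0 < f n) (k : ℕ) :
    ∃ C > 0, ∀ m ≤ k, f m ≤ C :=
  ⟨∑ m ∈ Finset.range (k + 1), f m, Finset.sum_pos (fun m _ => hf m) (by simp), fun m hm =>
    Finset.single_le_sum (f := f) (fun i _ => (hf i).le) (Finset.mem_range.2 (by omega))⟩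

lemma weylFeature_zero (s u : ℝ) :
    weylFeature s 0 u = Real.exp (s ^ 2 / 2) * fourierExp s u := by simp [weylFeature]

lemma weylFeature_one (s u : ℝ) :
    weylFeature s 1 u = Real.exp (s ^ 2 / 2) * ((s + Complex.I * u) * fourierExp s u) := by
  simp [weylFeature]

lemma exp_sq_div_two_sq (y : ℝ) : Real.exp (y ^ 2 / 2) ^ 2 = Real.exp (y ^ 2) := by
  rw [← Real.exp_nat_mul]; congr 1; push_cast; ring

lemma prod_filter_abs_lt_one {ι : Type*} (s : Finset ι) (d : ι → ℝ) :
    ∏ j ∈ s.filter (fun j => |d j| < 1), |d j| = ∏ j ∈ s, min 1 |d j| := by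
  rw [Finset.prod_filter]
  refine Finset.prod_congr rfl fun j _ => ?_
  split_ifs with h
  · exact (min_eq_right h.le).symm
  · exact (min_eq_left (not_lt.1 h)).symm

lemma integral_gaussianReal_norm_sq_le {F : ℝ → ℂ} (hF : Continuous F) {m k : ℕ} (hm : m ≤ k)
    {P : ℝ} (h : ∀ t, ‖F t‖ ≤ |t| ^ m * P) :
    Integrable (fun t => ‖F t‖ ^ 2) (gaussianReal 0 1) ∧
    ∫ t, ‖F t‖ ^ 2 ∂(gaussianReal 0 1) ≤
      (∫ t : ℝ, (1 + |t|) ^ (2 * k) ∂(gaussianReal 0 1)) * P ^ 2 := by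
  have hb : ∀ t, ‖F t‖ ^ 2 ≤ (1 + |t|) ^ (2 * k) * P ^ 2 := by
    intro t
    calc ‖F t‖ ^ 2 ≤ (|t| ^ m * P) ^ 2 := by gcongr; exact h t
      _ = |t| ^ (2 * m) * P ^ 2 := by ring
      _ ≤ (1 + |t|) ^ (2 * m) * P ^ 2 := by gcongr; linarith
      _ ≤ _ := by
        gcongr
        linarith [abs_nonneg t]
  have hi := (integrable_one_add_abs_pow_gaussianReal (2 * k)).mul_const (P ^ 2)
  have hi' : Integrable (fun t => ‖F t‖ ^ 2) (gaussianReal 0 1) :=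
    hi.mono' (by fun_prop) (Eventually.of_forall fun t => by
      rw [Real.norm_of_nonneg (by positivity)]; exact hb t)
  refine ⟨hi', ?_⟩
  rw [← integral_mul_const]
  exact integral_mono hi' hi hb

lemma integral_one_add_abs_pow_pos (n : ℕ) :
    0 < ∫ t : ℝ, (1 + |t|) ^ n ∂(gaussianReal 0 1) := by
  have h := integral_mono (integrable_const (1 : ℝ)) (integrable_one_add_abs_pow_gaussianReal n)
    (fun t => one_le_pow₀ (by linarith [abs_nonneg t]))
  have h1 : ∫ _ : ℝ, (1 : ℝ) ∂(gaussianReal 0 1) = 1 := by simp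
  rw [h1] at h
  linarith

/-- Upper and lower bounds for the squared distance in `L²` of the standard Gaussian measure of
one evaluation functional to the span of others. -/
lemma exists_weylFeature_value_bounds (k : ℕ) : ∃ c C : ℝ, 0 < c ∧ 0 < C ∧
    ∀ {ι : Type} (s : Finset ι) (x : ι → ℝ) (y : ℝ), s.card ≤ k →
    (∀ v : ι → ℝ,
      Integrable (fun u => ‖weylFeature y 0 u + ∑ j ∈ s, (v j : ℂ) * weylFeature (x j) 0 u‖ ^ 2)
        (gaussianReal 0 1) →
      c * (Real.exp (y ^ 2) * (∏ j ∈ s, min 1 |y - x j|) ^ 2) ≤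
        ∫ u, ‖weylFeature y 0 u + ∑ j ∈ s, (v j : ℂ) * weylFeature (x j) 0 u‖ ^ 2
          ∂(gaussianReal 0 1)) ∧
    (Set.InjOn x s → (∀ j ∈ s, x j ≠ y) → ∃ v : ι → ℝ,
      ∫ u, ‖weylFeature y 0 u + ∑ j ∈ s, (v j : ℂ) * weylFeature (x j) 0 u‖ ^ 2
          ∂(gaussianReal 0 1) ≤ C * (Real.exp (y ^ 2) * (∏ j ∈ s, min 1 |y - x j|) ^ 2)) := by
  obtain ⟨K, hK, hKm⟩ := exists_pos_forall_le_nat (fun m => (π ^ 2) ^ m *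
    (Real.sqrt (2 * π) * Real.exp ((m + 1 : ℝ) ^ 2 / 2)))
    (fun m => by have := Real.pi_pos; positivity) k
  refine ⟨K⁻¹, ∫ t : ℝ, (1 + |t|) ^ (2 * k) ∂(gaussianReal 0 1), inv_pos.2 hK,
    integral_one_add_abs_pow_pos _, fun {ι} s x y hs => ⟨fun v hi => ?_, fun hinj hy => ?_⟩⟩
  · have h1 := le_integral_norm_sq_exponential_sum x y s (Real.exp (y ^ 2 / 2) : ℂ)
      (fun j => (v j : ℂ) * (Real.exp (x j ^ 2 / 2) : ℂ))
    have hfun : ∀ u, (Real.exp (y ^ 2 / 2) : ℂ) * fourierExp y u +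
        ∑ j ∈ s, (v j : ℂ) * (Real.exp (x j ^ 2 / 2) : ℂ) * fourierExp (x j) u =
        weylFeature y 0 u + ∑ j ∈ s, (v j : ℂ) * weylFeature (x j) 0 u := by
      intro u
      simp only [weylFeature_zero, mul_assoc]
    simp only [hfun] at h1
    rw [Complex.norm_real, Real.norm_of_nonneg (Real.exp_pos _).le, exp_sq_div_two_sq,
      Finset.prod_pow] at h1
    have h2 := intervalIntegral_le_mul_integral_gaussianReal (N := s.card + 1) (by positivity)
      (fun u => by positivity) (by fun_prop) hi
    rw [inv_mul_le_iff₀ hK]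
    refine h1.trans ((mul_le_mul_of_nonneg_left h2 (by positivity)).trans ?_)
    rw [← mul_assoc]
    exact mul_le_mul_of_nonneg_right (hKm _ hs) (integral_nonneg fun u => by positivity)
  · obtain ⟨w, hw⟩ := exists_exponential_sum_norm_le x y (s.filter (fun j => |y - x j| < 1))
      (hinj.mono (Finset.coe_subset.2 (Finset.filter_subset _ _)))
      (fun j hj => hy j (Finset.mem_filter.1 hj).1)
    rw [prod_filter_abs_lt_one] at hw
    let v : ι → ℝ := fun j => if |y - x j| < 1 then
      Real.exp (y ^ 2 / 2) * w j / Real.exp (x j ^ 2 / 2) else 0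
    have hfun : ∀ u, weylFeature y 0 u + ∑ j ∈ s, (v j : ℂ) * weylFeature (x j) 0 u =
        (Real.exp (y ^ 2 / 2) : ℂ) * (fourierExp y u +
          ∑ j ∈ s.filter (fun j => |y - x j| < 1), (w j : ℂ) * fourierExp (x j) u) := by
      intro u
      rw [mul_add, weylFeature_zero, Finset.mul_sum, Finset.sum_filter]
      congr 1
      refine Finset.sum_congr rfl fun j _ => ?_
      simp only [v]
      split_ifs
      · rw [weylFeature_zero]
        have : (Real.exp (x j ^ 2 / 2) : ℂ) ≠ 0 := by exact_mod_cast (Real.exp_pos _).ne'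
        push_cast at this ⊢
        field_simp
      · simp
    refine ⟨v, (integral_gaussianReal_norm_sq_le (by fun_prop)
      (m := (s.filter (fun j => |y - x j| < 1)).card) ((Finset.card_filter_le _ _).trans hs)
      (P := Real.exp (y ^ 2 / 2) * ∏ j ∈ s, min 1 |y - x j|) fun u => ?_).2.trans (le_of_eq ?_)⟩
    · rw [hfun, norm_mul, Complex.norm_real, Real.norm_of_nonneg (Real.exp_pos _).le, mul_left_comm]
      gcongr
      exact hw u
    · rw [mul_pow, exp_sq_div_two_sq]

/-- The analogue of `exists_weylFeature_value_bounds` for a derivative functional. -/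
lemma exists_weylFeature_deriv_bounds (k : ℕ) : ∃ c C : ℝ, 0 < c ∧ 0 < C ∧
    ∀ {ι : Type} (s : Finset ι) (x : ι → ℝ) (y : ℝ), s.card ≤ k →
    (∀ (v₀ : ℝ) (v : ι → ℝ),
      Integrable (fun u => ‖weylFeature y 1 u + (v₀ : ℂ) * weylFeature y 0 u +
        ∑ j ∈ s, (v j : ℂ) * weylFeature (x j) 0 u‖ ^ 2) (gaussianReal 0 1) →
      c * (Real.exp (y ^ 2) * (∏ j ∈ s, min 1 |y - x j|) ^ 2) ≤
        ∫ u, ‖weylFeature y 1 u + (v₀ : ℂ) * weylFeature y 0 u +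
          ∑ j ∈ s, (v j : ℂ) * weylFeature (x j) 0 u‖ ^ 2 ∂(gaussianReal 0 1)) ∧
    (Set.InjOn x s → (∀ j ∈ s, x j ≠ y) → ∃ (v₀ : ℝ) (v : ι → ℝ),
      ∫ u, ‖weylFeature y 1 u + (v₀ : ℂ) * weylFeature y 0 u +
          ∑ j ∈ s, (v j : ℂ) * weylFeature (x j) 0 u‖ ^ 2
          ∂(gaussianReal 0 1) ≤ C * (Real.exp (y ^ 2) * (∏ j ∈ s, min 1 |y - x j|) ^ 2)) := by
  obtain ⟨K, hK, hKm⟩ := exists_pos_forall_le_nat (fun m => 4 * (π ^ 2) ^ m *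
    (Real.sqrt (2 * π) * Real.exp ((m + 2 : ℝ) ^ 2 / 2)))
    (fun m => by have := Real.pi_pos; positivity) k
  refine ⟨K⁻¹, ∫ t : ℝ, (1 + |t|) ^ (2 * (k + 1)) ∂(gaussianReal 0 1), inv_pos.2 hK,
    integral_one_add_abs_pow_pos _, fun {ι} s x y hs => ⟨fun v₀ v hi => ?_, fun hinj hy => ?_⟩⟩
  · have h1 := le_integral_norm_sq_exponential_sum_deriv x y s
      ((Real.exp (y ^ 2 / 2) : ℂ) * (y + v₀)) ((Real.exp (y ^ 2 / 2) : ℂ) * Complex.I)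
      (fun j => (v j : ℂ) * (Real.exp (x j ^ 2 / 2) : ℂ))
    have hfun : ∀ u : ℝ, ((Real.exp (y ^ 2 / 2) : ℂ) * (y + v₀) +
        (Real.exp (y ^ 2 / 2) : ℂ) * Complex.I * u) * fourierExp y u +
        ∑ j ∈ s, (v j : ℂ) * (Real.exp (x j ^ 2 / 2) : ℂ) * fourierExp (x j) u =
        weylFeature y 1 u + (v₀ : ℂ) * weylFeature y 0 u +
          ∑ j ∈ s, (v j : ℂ) * weylFeature (x j) 0 u := by
      intro u
      simp only [weylFeature_zero, weylFeature_one, mul_assoc]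
      ring
    simp only [hfun] at h1
    rw [norm_mul, Complex.norm_I, mul_one,
      Complex.norm_real, Real.norm_of_nonneg (Real.exp_pos _).le, exp_sq_div_two_sq,
      Finset.prod_pow] at h1
    have h2 := intervalIntegral_le_mul_integral_gaussianReal (N := s.card + 2) (by positivity)
      (fun u => by positivity) (by fun_prop) hi
    rw [inv_mul_le_iff₀ hK]
    refine h1.trans ((mul_le_mul_of_nonneg_left h2 (by positivity)).trans ?_)
    rw [← mul_assoc]
    exact mul_le_mul_of_nonneg_right (hKm _ hs) (integral_nonneg fun u => by positivity)
  · obtain ⟨w₀, w, hw⟩ := exists_exponential_sum_deriv_norm_le x y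
      (s.filter (fun j => |y - x j| < 1))
      (hinj.mono (Finset.coe_subset.2 (Finset.filter_subset _ _)))
      (fun j hj => hy j (Finset.mem_filter.1 hj).1)
    rw [prod_filter_abs_lt_one] at hw
    let v : ι → ℝ := fun j => if |y - x j| < 1 then
      Real.exp (y ^ 2 / 2) * w j / Real.exp (x j ^ 2 / 2) else 0
    have hfun : ∀ u : ℝ, weylFeature y 1 u + ((w₀ - y : ℝ) : ℂ) * weylFeature y 0 u +
        ∑ j ∈ s, (v j : ℂ) * weylFeature (x j) 0 u =
        (Real.exp (y ^ 2 / 2) : ℂ) * ((w₀ + Complex.I * u) * fourierExp y u +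
          ∑ j ∈ s.filter (fun j => |y - x j| < 1), (w j : ℂ) * fourierExp (x j) u) := by
      intro u
      rw [mul_add, weylFeature_zero, weylFeature_one, Finset.mul_sum, Finset.sum_filter]
      congr 1
      · push_cast; ring
      refine Finset.sum_congr rfl fun j _ => ?_
      simp only [v]
      split_ifs
      · rw [weylFeature_zero]
        have : (Real.exp (x j ^ 2 / 2) : ℂ) ≠ 0 := by exact_mod_cast (Real.exp_pos _).ne'
        push_cast at this ⊢
        field_simp
      · simp
    refine ⟨w₀ - y, v, (integral_gaussianReal_norm_sq_le (by fun_prop)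
      (m := (s.filter (fun j => |y - x j| < 1)).card + 1)
      (Nat.succ_le_succ ((Finset.card_filter_le _ _).trans hs))
      (P := Real.exp (y ^ 2 / 2) * ∏ j ∈ s, min 1 |y - x j|) fun u => ?_).2.trans (le_of_eq ?_)⟩
    · rw [hfun, norm_mul, Complex.norm_real, Real.norm_of_nonneg (Real.exp_pos _).le, mul_left_comm]
      gcongr
      exact hw u
    · rw [mul_pow, exp_sq_div_two_sq]

open Matrix in
/-- The Schur complement of the upper left block of a symmetric block matrix describes the
minimum of the quadratic form over the first group of variables. -/
lemma schur_complement_quadratic_form {m n : Type*} [Fintype m] [Fintype n] [DecidableEq m]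
    [DecidableEq n] (M : Matrix (m ⊕ n) (m ⊕ n) ℝ) (hM : M.IsHermitian)
    (hA : M.toBlocks₁₁.PosDef) :
    ∃ S : Matrix n n ℝ, S.IsHermitian ∧ M.det = M.toBlocks₁₁.det * S.det ∧
      (∀ e : n → ℝ, ∃ c : m → ℝ, e ⬝ᵥ S *ᵥ e = Sum.elim c e ⬝ᵥ M *ᵥ Sum.elim c e) ∧
      (∀ (c : m → ℝ) (e : n → ℝ), e ⬝ᵥ S *ᵥ e ≤ Sum.elim c e ⬝ᵥ M *ᵥ Sum.elim c e) ∧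
      (S.det ≠ 0 → ∀ e : n → ℝ,
        Sum.elim (0 : m → ℝ) e ⬝ᵥ M⁻¹ *ᵥ Sum.elim (0 : m → ℝ) e = e ⬝ᵥ S⁻¹ *ᵥ e) := by
  set A := M.toBlocks₁₁ with hAdef
  set B := M.toBlocks₁₂ with hBdef
  set D := M.toBlocks₂₂ with hDdef
  have hC : M.toBlocks₂₁ = Bᴴ := by
    ext i j
    exact (hM.apply (Sum.inr i) (Sum.inl j)).symm
  have hMb : M = fromBlocks A B Bᴴ D := by rw [← hC, fromBlocks_toBlocks]
  have hDh : D.IsHermitian := by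
    ext i j
    exact hM.apply (Sum.inr i) (Sum.inr j)
  have : Invertible A := hA.isUnit.invertible
  have hAh := hA.isHermitian
  have hS : (D - Bᴴ * A⁻¹ * B).IsHermitian := by
    refine hDh.sub ?_
    exact isHermitian_conjTranspose_mul_mul B hAh.inv
  have hq : ∀ (c : m → ℝ) (e : n → ℝ), Sum.elim c e ⬝ᵥ M *ᵥ Sum.elim c e =
      (c + (A⁻¹ * B) *ᵥ e) ⬝ᵥ A *ᵥ (c + (A⁻¹ * B) *ᵥ e) +
        e ⬝ᵥ (D - Bᴴ * A⁻¹ * B) *ᵥ e := by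
    intro c e
    have h := schur_complement_eq₁₁ B D c e hAh
    rw [← hMb] at h
    simpa only [star_trivial, dotProduct_mulVec] using h
  have hdet : M.det = A.det * (D - Bᴴ * A⁻¹ * B).det := by
    rw [hMb, det_fromBlocks₁₁, invOf_eq_nonsing_inv]
  refine ⟨D - Bᴴ * A⁻¹ * B, hS, hdet, ?_, ?_, ?_⟩
  · intro e
    refine ⟨-((A⁻¹ * B) *ᵥ e), ?_⟩
    rw [hq]; simp
  · intro c e
    rw [hq]
    have := hA.posSemidef.dotProduct_mulVec_nonneg (c + (A⁻¹ * B) *ᵥ e)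
    rw [star_trivial] at this
    linarith
  · intro hSd e
    set S := D - Bᴴ * A⁻¹ * B with hSdef
    have hMd : IsUnit M.det := by
      rw [hdet]; exact (hA.det_pos.ne'.isUnit).mul hSd.isUnit
    have hSu : IsUnit S.det := hSd.isUnit
    have hsol : M *ᵥ Sum.elim (-((A⁻¹ * B) *ᵥ (S⁻¹ *ᵥ e))) (S⁻¹ *ᵥ e) =
        Sum.elim (0 : m → ℝ) e := by
      rw [hMb, fromBlocks_mulVec]
      have hAu : IsUnit A.det := hA.det_pos.ne'.isUnit
      congr 1
      · rw [Sum.elim_comp_inl, Sum.elim_comp_inr, mulVec_neg, mulVec_mulVec, ← Matrix.mul_assoc,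
          mul_nonsing_inv _ hAu, Matrix.one_mul, neg_add_cancel]
      · rw [Sum.elim_comp_inl, Sum.elim_comp_inr, mulVec_neg, mulVec_mulVec, neg_add_eq_sub,
          ← sub_mulVec, ← Matrix.mul_assoc, ← hSdef, mulVec_mulVec, mul_nonsing_inv _ hSu,
          one_mulVec]
    have hinv : M⁻¹ *ᵥ Sum.elim (0 : m → ℝ) e =
        Sum.elim (-((A⁻¹ * B) *ᵥ (S⁻¹ *ᵥ e))) (S⁻¹ *ᵥ e) := by
      rw [← hsol, mulVec_mulVec, nonsing_inv_mul _ hMd, one_mulVec]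
    rw [hinv, sumElim_dotProduct_sumElim]
    simp

/-- The Gram matrix of a finite family of value and derivative functionals. -/
def weylGram {κ : Type*} (x : κ → ℝ) (a : κ → Fin 2) : Matrix κ κ ℝ :=
  fun p q => weylCov (x p) (x q) (a p) (a q)

lemma weylCov_symm (s t : ℝ) (a b : Fin 2) : weylCov s t a b = weylCov t s b a := by
  unfold weylCov
  fin_cases a <;> fin_cases b <;> simp [mul_comm]

lemma weylGram_isHermitian {κ : Type*} (x : κ → ℝ) (a : κ → Fin 2) :
    (weylGram x a).IsHermitian := by
  ext i j
  simp [weylGram, weylCov_symm (x j)]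

open Matrix in
lemma dotProduct_weylGram_mulVec {κ : Type*} [Fintype κ] (x : κ → ℝ) (a : κ → Fin 2)
    (v : κ → ℝ) : v ⬝ᵥ weylGram x a *ᵥ v =
      ∫ u, ‖∑ p, (v p : ℂ) * weylFeature (x p) (a p) u‖ ^ 2 ∂(gaussianReal 0 1) := by
  rw [← sum_mul_weylCov_mul]
  simp only [dotProduct, mulVec, weylGram, Finset.mul_sum, mul_assoc]

lemma eq_zero_of_integral_gaussianReal_norm_sq_eq_zero {F : ℝ → ℂ} (hF : Continuous F)
    (hi : Integrable (fun u => ‖F u‖ ^ 2) (gaussianReal 0 1))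
    (h : ∫ u, ‖F u‖ ^ 2 ∂(gaussianReal 0 1) = 0) (u : ℝ) : F u = 0 := by
  rw [integral_eq_zero_iff_of_nonneg (fun u => by positivity) hi] at h
  have h1 := (gaussianReal_absolutelyContinuous' 0 one_ne_zero).ae_le h
  have h2 : (fun u => ‖F u‖ ^ 2) = fun _ => (0 : ℝ) :=
    (Continuous.ae_eq_iff_eq (μ := volume) (by fun_prop) continuous_const).1 h1
  simpa using congrFun h2 u

open Matrix in
lemma posDef_of_dotProduct_pos {n : Type*} [Fintype n] {S : Matrix n n ℝ} (hS : S.IsHermitian)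
    (h : ∀ e : n → ℝ, e ≠ 0 → 0 < e ⬝ᵥ S *ᵥ e) : S.PosDef :=
  PosDef.of_dotProduct_mulVec_pos hS fun e he => by simpa using h e he

open Matrix in
lemma weylGram_jet_pos {k : ℕ} {x : Fin k → ℝ} (hx : Function.Injective x) (c e : Fin k → ℝ)
    (hce : c ≠ 0 ∨ e ≠ 0) :
    0 < Sum.elim c e ⬝ᵥ weylGram (Sum.elim x x) (Sum.elim (fun _ => 0) fun _ => 1) *ᵥ
      Sum.elim c e := by
  rw [dotProduct_weylGram_mulVec]
  refine lt_of_le_of_ne (integral_nonneg fun u => by positivity) fun h => ?_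
  have h0 := eq_zero_of_integral_gaussianReal_norm_sq_eq_zero (by fun_prop)
    (integrable_norm_sq_sum_weylFeature _ _ _) h.symm
  have hz := coeff_eq_zero_of_sum_eq_zero x Finset.univ hx.injOn
    (fun j => (Real.exp (x j ^ 2 / 2) : ℂ) * (c j + e j * x j))
    (fun j => (Real.exp (x j ^ 2 / 2) : ℂ) * (Complex.I * e j)) (fun t => by
      rw [← h0 t, Fintype.sum_sum_type, ← Finset.sum_add_distrib]
      refine Finset.sum_congr rfl fun j _ => ?_
      simp only [Sum.elim_inl, Sum.elim_inr, weylFeature_zero, weylFeature_one]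
      ring)
  have he : e = 0 := by
    funext j
    have := (hz j (Finset.mem_univ j)).2
    simpa [Complex.exp_ne_zero] using this
  have hc : c = 0 := by
    funext j
    have := (hz j (Finset.mem_univ j)).1
    simpa [Complex.exp_ne_zero, he] using this
  rcases hce with h | h <;> contradiction

open Matrix in
lemma weylGram_value_posDef {k : ℕ} {x : Fin k → ℝ} (hx : Function.Injective x) :
    (weylGram x fun _ => 0).PosDef := by
  refine posDef_of_dotProduct_pos (weylGram_isHermitian _ _) fun c hc => ?_
  have h := weylGram_jet_pos hx c 0 (Or.inl hc)
  rw [dotProduct_weylGram_mulVec] at h ⊢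
  simpa using h

open Matrix in
/-- Up to constants, the determinant of the covariance of the values is given by the product of
the truncated squared distances. -/
lemma exists_det_weylGram_bounds (k : ℕ) : ∃ c C : ℝ, 0 < c ∧ 0 < C ∧
    ∀ x : Fin k → ℝ, Function.Injective x →
      c * ∏ i, (Real.exp (x i ^ 2) * (∏ j ∈ Finset.Iio i, min 1 |x i - x j|) ^ 2) ≤
        (weylGram x fun _ => 0).det ∧
      (weylGram x fun _ => 0).det ≤
        C * ∏ i, (Real.exp (x i ^ 2) * (∏ j ∈ Finset.Iio i, min 1 |x i - x j|) ^ 2) := by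
  induction k with
  | zero => exact ⟨1, 1, one_pos, one_pos, fun x _ => by simp⟩
  | succ k ih =>
    obtain ⟨c, C, hc, hC, ih⟩ := ih
    obtain ⟨d, D, hd, hD, hb⟩ := exists_weylFeature_value_bounds k
    refine ⟨c * d, C * D, by positivity, by positivity, fun x hx => ?_⟩
    set x' : Fin k → ℝ := fun i => x i.castSucc with hx'
    have hx'i : Function.Injective x' := hx.comp (Fin.castSucc_injective k)
    set y := x (Fin.last k) with hy
    set M := weylGram (Sum.elim x' fun _ : Fin 1 => y) (fun _ => 0) with hM
    have hdet : (weylGram x fun _ => 0).det = M.det := by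
      have : M = (weylGram x fun _ => 0).submatrix finSumFinEquiv finSumFinEquiv := by
        ext p q
        have hp : ∀ p : Fin k ⊕ Fin 1, Sum.elim x' (fun _ => y) p = x (finSumFinEquiv p) := by
          rintro (p | p)
          · simp [hx']; rfl
          · simp [hy, Subsingleton.elim p 0]; rfl
        simp only [hM, weylGram, submatrix_apply, hp]
      rw [this, det_submatrix_equiv_self]
    have hM11 : M.toBlocks₁₁ = weylGram x' fun _ => 0 := rfl
    obtain ⟨S, -, hSdet, hS1, hS2, -⟩ := schur_complement_quadratic_form M
      (weylGram_isHermitian _ _) (hM11 ▸ weylGram_value_posDef hx'i)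
    rw [hM11] at hSdet
    have hSdet' : ∀ S : Matrix (Fin 1) (Fin 1) ℝ,
        (fun _ => 1 : Fin 1 → ℝ) ⬝ᵥ S *ᵥ (fun _ => 1) = S.det := by
      intro S; simp [dotProduct, mulVec]
    have hquad : ∀ v : Fin k → ℝ, Sum.elim v (fun _ => 1) ⬝ᵥ M *ᵥ Sum.elim v (fun _ => 1) =
        ∫ u, ‖weylFeature y 0 u + ∑ j, (v j : ℂ) * weylFeature (x' j) 0 u‖ ^ 2
          ∂(gaussianReal 0 1) := by
      intro v
      rw [hM, dotProduct_weylGram_mulVec]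
      simp [add_comm]
    have h_int : ∀ v : Fin k → ℝ, Integrable (fun u =>
        ‖weylFeature y 0 u + ∑ j, (v j : ℂ) * weylFeature (x' j) 0 u‖ ^ 2) (gaussianReal 0 1) := by
      intro v
      have h := integrable_norm_sq_sum_weylFeature (Sum.elim x' fun _ : Fin 1 => y)
        (fun _ => 0) (Sum.elim v fun _ => 1)
      simpa [add_comm] using h
    obtain ⟨hlow, hup⟩ := hb Finset.univ x' y (by simp)
    have hyx : ∀ j, x' j ≠ y := fun j h => (Fin.castSucc_lt_last j).ne (hx h)
    obtain ⟨v, hv⟩ := hup hx'i.injOn fun j _ => hyx j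
    have hSu : S.det ≤ D * (Real.exp (y ^ 2) * (∏ j, min 1 |y - x' j|) ^ 2) := by
      rw [← hSdet']
      exact (hS2 v _).trans ((hquad v).le.trans hv)
    have hSl : d * (Real.exp (y ^ 2) * (∏ j, min 1 |y - x' j|) ^ 2) ≤ S.det := by
      obtain ⟨w, hw⟩ := hS1 fun _ => 1
      rw [← hSdet', hw, hquad]
      exact hlow w (h_int w)
    obtain ⟨ihl, ihu⟩ := ih x' hx'i
    have hprod : ∏ i, (Real.exp (x i ^ 2) * (∏ j ∈ Finset.Iio i, min 1 |x i - x j|) ^ 2) =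
        (∏ i, (Real.exp (x' i ^ 2) * (∏ j ∈ Finset.Iio i, min 1 |x' i - x' j|) ^ 2)) *
          (Real.exp (y ^ 2) * (∏ j, min 1 |y - x' j|) ^ 2) := by
      rw [Fin.prod_univ_castSucc]
      congr 1
      · refine Finset.prod_congr rfl fun i _ => ?_
        rw [Fin.prod_Iio_castSucc]
      · have : Finset.Iio (Fin.last k) = Finset.univ.map Fin.castSuccEmb := by
          ext j; simp [Fin.exists_castSucc_eq]
        rw [this, Finset.prod_map]
        rfl
    rw [hdet, hSdet, hprod]
    have hP : 0 ≤ ∏ i, (Real.exp (x' i ^ 2) * (∏ j ∈ Finset.Iio i, min 1 |x' i - x' j|) ^ 2) :=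
      Finset.prod_nonneg fun i _ => by positivity
    have hdetpos := (weylGram_value_posDef hx'i).det_pos
    constructor
    · calc _ = (c * ∏ i, (Real.exp (x' i ^ 2) * (∏ j ∈ Finset.Iio i, min 1 |x' i - x' j|) ^ 2)) *
            (d * (Real.exp (y ^ 2) * (∏ j, min 1 |y - x' j|) ^ 2)) := by ring
        _ ≤ _ := by gcongr
    · calc _ ≤ (C * ∏ i, (Real.exp (x' i ^ 2) * (∏ j ∈ Finset.Iio i, min 1 |x' i - x' j|) ^ 2)) *
            (D * (Real.exp (y ^ 2) * (∏ j, min 1 |y - x' j|) ^ 2)) :=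
            mul_le_mul ihu hSu (le_trans (by positivity) hSl) (by positivity)
        _ = _ := by ring

open Matrix in
/-- The covariance `S` of the derivatives conditioned on the values being zero. -/
lemma exists_conditional_covariance_bounds (k : ℕ) : ∃ c C : ℝ, 0 < c ∧ 0 < C ∧
    ∀ x : Fin k → ℝ, Function.Injective x → ∃ S : Matrix (Fin k) (Fin k) ℝ, S.PosDef ∧
      (weylGamma x).det = (weylGram x fun _ => 0).det * S.det ∧
      (∀ η : Fin k → ℝ, ∑ p, (weylGamma x)⁻¹.mulVec (weylEta η) p * weylEta η p =
        η ⬝ᵥ S⁻¹ *ᵥ η) ∧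
      ∀ i, c * (Real.exp (x i ^ 2) * (∏ j ∈ {i}ᶜ, min 1 |x i - x j|) ^ 2) ≤ S i i ∧
        S i i ≤ C * (Real.exp (x i ^ 2) * (∏ j ∈ {i}ᶜ, min 1 |x i - x j|) ^ 2) := by
  obtain ⟨c, C, hc, hC, hb⟩ := exists_weylFeature_deriv_bounds k
  refine ⟨c, C, hc, hC, fun x hx => ?_⟩
  set M := weylGram (Sum.elim x x) (Sum.elim (fun _ => 0) fun _ => 1) with hM
  have hM11 : M.toBlocks₁₁ = weylGram x fun _ => 0 := rfl
  obtain ⟨S, hSh, hSdet, hS1, hS2, hSinv⟩ := schur_complement_quadratic_form M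
    (weylGram_isHermitian _ _) (hM11 ▸ weylGram_value_posDef hx)
  rw [hM11] at hSdet
  have hSpos : S.PosDef := posDef_of_dotProduct_pos hSh fun e he => by
    obtain ⟨w, hw⟩ := hS1 e
    rw [hw]
    exact weylGram_jet_pos hx w e (Or.inr he)
  let ε : Fin k ⊕ Fin k ≃ Fin k × Fin 2 :=
    { toFun := Sum.elim (fun i => (i, 0)) fun i => (i, 1)
      invFun := fun p => if p.2 = 0 then Sum.inl p.1 else Sum.inr p.1
      left_inv := by rintro (i | i) <;> simp
      right_inv := by rintro ⟨i, a⟩; fin_cases a <;> simp }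
  have hMsub : M = (weylGamma x).submatrix ε ε := by
    ext p q
    rcases p with p | p <;> rcases q with q | q <;> rfl
  have heta : ∀ η : Fin k → ℝ, weylEta η ∘ ε = Sum.elim (0 : Fin k → ℝ) η := by
    intro η
    funext p
    rcases p with p | p <;> simp [ε, weylEta]
  refine ⟨S, hSpos, ?_, fun η => ?_, fun i => ?_⟩
  · rw [← hSdet, hMsub, det_submatrix_equiv_self]
  · rw [← hSinv hSpos.det_pos.ne' η, hMsub, inv_submatrix_equiv, ← heta η,
      submatrix_mulVec_equiv, dotProduct, ← ε.sum_comp]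
    refine Finset.sum_congr rfl fun p _ => ?_
    have : (weylEta η ∘ ε) ∘ ε.symm = weylEta η := by funext p; simp
    rw [this, mul_comm]
    rfl
  · have hSii : (Pi.single i 1 : Fin k → ℝ) ⬝ᵥ S *ᵥ Pi.single i 1 = S i i := by simp
    have hsplit : ∀ (v : Fin k → ℝ) (u : ℝ),
        ∑ p : Fin k ⊕ Fin k, ((Sum.elim v (Pi.single i 1 : Fin k → ℝ) p : ℝ) : ℂ) *
          weylFeature (Sum.elim x x p) (Sum.elim (fun _ => 0) (fun _ => 1) p) u =
        weylFeature (x i) 1 u + (v i : ℂ) * weylFeature (x i) 0 u +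
          ∑ j ∈ {i}ᶜ, (v j : ℂ) * weylFeature (x j) 0 u := by
      intro v u
      rw [Fintype.sum_sum_type, add_assoc,
        ← Fintype.sum_eq_add_sum_compl i fun j => (v j : ℂ) * weylFeature (x j) 0 u, add_comm]
      congr 1
      rw [Finset.sum_eq_single i (fun j _ hj => by simp [hj]) (by simp)]
      simp
    have hquad : ∀ v : Fin k → ℝ,
        Sum.elim v (Pi.single i 1) ⬝ᵥ M *ᵥ Sum.elim v (Pi.single i 1) =
        ∫ u, ‖weylFeature (x i) 1 u + (v i : ℂ) * weylFeature (x i) 0 u +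
          ∑ j ∈ {i}ᶜ, (v j : ℂ) * weylFeature (x j) 0 u‖ ^ 2 ∂(gaussianReal 0 1) := by
      intro v
      rw [hM, dotProduct_weylGram_mulVec]
      simp only [hsplit]
    have h_int : ∀ v : Fin k → ℝ, Integrable (fun u =>
        ‖weylFeature (x i) 1 u + (v i : ℂ) * weylFeature (x i) 0 u +
          ∑ j ∈ {i}ᶜ, (v j : ℂ) * weylFeature (x j) 0 u‖ ^ 2) (gaussianReal 0 1) := by
      intro v
      have h := integrable_norm_sq_sum_weylFeature (Sum.elim x x)
        (Sum.elim (fun _ => 0) (fun _ => 1)) (Sum.elim v (Pi.single i 1))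
      simpa only [hsplit] using h
    obtain ⟨hlow, hup⟩ := hb {i}ᶜ x (x i) ((Finset.card_le_univ _).trans (by simp))
    constructor
    · obtain ⟨w, hw⟩ := hS1 (Pi.single i 1)
      rw [← hSii, hw, hquad]
      exact hlow (w i) w (h_int w)
    · obtain ⟨v₀, v, hv⟩ := hup hx.injOn fun j hj h => by
        simp [hx h] at hj
      rw [← hSii]
      refine (hS2 (Function.update v i v₀) _).trans ?_
      rw [hquad]
      refine le_of_eq_of_le ?_ hv
      congr 1
      funext u
      rw [Function.update_self]
      congr 3
      refine Finset.sum_congr rfl fun j hj => ?_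
      rw [Function.update_of_ne (by simpa using hj)]

lemma abs_sum_mul_le_sum_abs {k : ℕ} {r : Fin k → ℝ} (hr : ∑ j, r j ^ 2 = 1) (z : Fin k → ℝ) :
    |∑ j, r j * z j| ≤ ∑ j, |z j| := by
  refine (Finset.abs_sum_le_sum_abs _ _).trans (Finset.sum_le_sum fun j _ => ?_)
  rw [abs_mul]
  have h : r j ^ 2 ≤ 1 := hr ▸ Finset.single_le_sum (f := fun j => r j ^ 2)
    (fun i _ => sq_nonneg _) (Finset.mem_univ j)
  exact mul_le_of_le_one_left (abs_nonneg _) ((sq_le_one_iff_abs_le_one _).1 h)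

lemma pow_sum_abs_mul_exp_le (k : ℕ) (z : Fin k → ℝ) :
    (∑ j, |z j|) ^ k * Real.exp (-(1 / 2) * ∑ j, z j ^ 2) ≤
      k.factorial * ∏ j, (Real.exp 1 * Real.exp (-(1 / 4) * z j ^ 2)) := by
  have h1 := Real.pow_div_factorial_le_exp (∑ j, |z j|)
    (Finset.sum_nonneg fun j _ => abs_nonneg (z j)) k
  rw [div_le_iff₀' (by positivity)] at h1
  refine (mul_le_mul_of_nonneg_right h1 (Real.exp_nonneg _)).trans ?_
  rw [mul_assoc, ← Real.exp_add]
  simp_rw [← Real.exp_add]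
  rw [← Real.exp_sum]
  gcongr
  rw [Finset.mul_sum, ← Finset.sum_add_distrib]
  refine Finset.sum_le_sum fun j _ => ?_
  nlinarith [sq_nonneg (|z j| / 2 - 1), sq_abs (z j)]

/-- The expected absolute product of Gaussian variables with unit variances is bounded above and
below by positive constants. -/
lemma exists_integral_prod_abs_bounds (k : ℕ) : ∃ c C : ℝ, 0 < c ∧ 0 < C ∧
    ∀ r : Fin k → Fin k → ℝ, (∀ i, ∑ j, r i j ^ 2 = 1) →
      c ≤ ∫ z : Fin k → ℝ, (∏ i, |∑ j, r i j * z j|) * Real.exp (-(1 / 2) * ∑ j, z j ^ 2) ∧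
      ∫ z : Fin k → ℝ, (∏ i, |∑ j, r i j * z j|) * Real.exp (-(1 / 2) * ∑ j, z j ^ 2) ≤ C := by
  set K : Set (Fin k → Fin k → ℝ) := {r | ∀ i, ∑ j, r i j ^ 2 = 1} with hK
  set F : (Fin k → Fin k → ℝ) → (Fin k → ℝ) → ℝ := fun r z =>
    (∏ i, |∑ j, r i j * z j|) * Real.exp (-(1 / 2) * ∑ j, z j ^ 2) with hF
  have hcomp : IsCompact K := by
    refine Metric.isCompact_of_isClosed_isBounded ?_ ?_
    · simp only [hK, Set.ofPred_forall]
      exact isClosed_iInter fun i => isClosed_eq (by fun_prop) continuous_const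
    · refine (Metric.isBounded_closedBall (x := (0 : Fin k → Fin k → ℝ)) (r := 1)).subset ?_
      intro r hr
      rw [mem_closedBall_zero_iff, pi_norm_le_iff_of_nonneg zero_le_one]
      intro i
      rw [pi_norm_le_iff_of_nonneg zero_le_one]
      intro j
      have h : r i j ^ 2 ≤ 1 := hr i ▸ Finset.single_le_sum (f := fun j => r i j ^ 2)
        (fun i _ => sq_nonneg _) (Finset.mem_univ j)
      exact (sq_le_one_iff_abs_le_one _).1 h
  have hne : K.Nonempty := by
    refine ⟨fun i j => if i = j then 1 else 0, fun i => ?_⟩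
    simp
  have hcont : ∀ r, Continuous (F r) := fun r => by fun_prop
  have hnonneg : ∀ r z, 0 ≤ F r z := fun r z => by positivity
  have hbound : ∀ r ∈ K, ∀ z, ‖F r z‖ ≤
      k.factorial * ∏ j, (Real.exp 1 * Real.exp (-(1 / 4) * z j ^ 2)) := by
    intro r hr z
    rw [Real.norm_of_nonneg (hnonneg r z)]
    refine le_trans ?_ (pow_sum_abs_mul_exp_le k z)
    refine mul_le_mul_of_nonneg_right ?_ (Real.exp_nonneg _)
    refine (Finset.prod_le_prod (fun i _ => abs_nonneg _)
      fun i _ => abs_sum_mul_le_sum_abs (hr i) z).trans ?_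
    simp
  have hbi : Integrable fun z : Fin k → ℝ =>
      (k.factorial : ℝ) * ∏ j, (Real.exp 1 * Real.exp (-(1 / 4) * z j ^ 2)) :=
    (Integrable.fintype_prod fun _ =>
      (integrable_exp_neg_mul_sq (by norm_num : (0 : ℝ) < 1 / 4)).const_mul _).const_mul _
  have h_int : ∀ r ∈ K, Integrable (F r) := fun r hr =>
    hbi.mono' (hcont r).aestronglyMeasurable (ae_of_all _ (hbound r hr))
  have hIcont : ContinuousOn (fun r => ∫ z, F r z) K :=
    continuousOn_of_dominated (fun r _ => (hcont r).aestronglyMeasurable)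
      (fun r hr => ae_of_all _ (hbound r hr)) hbi
      (ae_of_all _ fun z => by simp only [hF]; fun_prop)
  have hpos : ∀ r ∈ K, 0 < ∫ z, F r z := by
    intro r hr
    obtain ⟨z, hz⟩ := Module.Dual.exists_forall_ne_zero_of_forall_exists
      (fun i => ∑ j, r i j • (LinearMap.proj j : (Fin k → ℝ) →ₗ[ℝ] ℝ)) fun i => by
        refine ⟨r i, ?_⟩
        have := hr i
        simp [← pow_two, this]
    refine integral_pos_of_integrable_nonneg_nonzero (x := z) (hcont r) (h_int r hr) (hnonneg r) ?_
    simp only [hF, mul_ne_zero_iff, Finset.prod_ne_zero_iff, abs_ne_zero]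
    exact ⟨fun i _ => by simpa using hz i, Real.exp_ne_zero _⟩
  obtain ⟨r₀, hr₀, hmin⟩ := hcomp.exists_isMinOn hne hIcont
  obtain ⟨r₁, hr₁, hmax⟩ := hcomp.exists_isMaxOn hne hIcont
  exact ⟨_, _, hpos r₀ hr₀, hpos r₁ hr₁, fun r hr => ⟨hmin hr, hmax hr⟩⟩

open Matrix in
lemma exists_eq_mul_transpose_of_posDef {n : Type*} [Fintype n] [DecidableEq n]
    {S : Matrix n n ℝ} (hS : S.PosDef) : ∃ B : Matrix n n ℝ, S = B * Bᵀ := by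
  open scoped MatrixOrder in
  obtain ⟨y, hy⟩ := CStarAlgebra.nonneg_iff_eq_star_mul_self.mp hS.posSemidef.nonneg
  exact ⟨yᵀ, by simpa [star_eq_conjTranspose] using hy⟩

open Matrix in
/-- Up to constants, the Gaussian integral of an absolute product of coordinates is the product
of the standard deviations. -/
lemma exists_integral_prod_abs_mul_exp_bounds (k : ℕ) : ∃ c C : ℝ, 0 < c ∧ 0 < C ∧
    ∀ S : Matrix (Fin k) (Fin k) ℝ, S.PosDef →
      c * (√S.det * ∏ i, √(S i i)) ≤
        ∫ η : Fin k → ℝ, (∏ i, |η i|) * Real.exp (-(1 / 2) * (η ⬝ᵥ S⁻¹ *ᵥ η)) ∧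
      ∫ η : Fin k → ℝ, (∏ i, |η i|) * Real.exp (-(1 / 2) * (η ⬝ᵥ S⁻¹ *ᵥ η)) ≤
        C * (√S.det * ∏ i, √(S i i)) := by
  obtain ⟨c, C, hc, hC, h⟩ := exists_integral_prod_abs_bounds k
  refine ⟨c, C, hc, hC, fun S hS => ?_⟩
  obtain ⟨B, hB⟩ := exists_eq_mul_transpose_of_posDef hS
  have hdet : S.det = B.det ^ 2 := by rw [hB, det_mul, det_transpose, sq]
  have hBd : B.det ≠ 0 := fun h0 => by
    have := hS.det_pos
    simp [hdet, h0] at this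
  have hBu : IsUnit B.det := hBd.isUnit
  have hdiag : ∀ i, S i i = ∑ j, B i j ^ 2 := fun i => by
    simp [hB, mul_apply, sq]
  have hσ : ∀ i, 0 < √(S i i) := fun i => Real.sqrt_pos.2 hS.diag_pos
  have hquad : ∀ z : Fin k → ℝ, (B *ᵥ z) ⬝ᵥ S⁻¹ *ᵥ (B *ᵥ z) = ∑ j, z j ^ 2 := by
    intro z
    have h1 : S⁻¹ *ᵥ (B *ᵥ z) = (Bᵀ)⁻¹ *ᵥ z := by
      rw [hB, Matrix.mul_inv_rev, mulVec_mulVec, Matrix.mul_assoc, nonsing_inv_mul _ hBu,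
        Matrix.mul_one]
    rw [h1, dotProduct_comm, ← dotProduct_transpose_mulVec, mulVec_mulVec,
      mul_nonsing_inv _ (by rwa [det_transpose]), one_mulVec]
    simp [dotProduct, sq]
  have hchange : ∫ η : Fin k → ℝ, (∏ i, |η i|) * Real.exp (-(1 / 2) * (η ⬝ᵥ S⁻¹ *ᵥ η)) =
      |B.det| * ∫ z : Fin k → ℝ, (∏ i, |(B *ᵥ z) i|) *
        Real.exp (-(1 / 2) * ∑ j, z j ^ 2) := by
    set g : (Fin k → ℝ) → ℝ := fun η =>
      (∏ i, |η i|) * Real.exp (-(1 / 2) * (η ⬝ᵥ S⁻¹ *ᵥ η)) with hg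
    have hgc : Continuous g := by
      simp only [hg, dotProduct, mulVec]
      fun_prop
    have hm : Measurable (toLin' B) := (LinearMap.continuous_of_finiteDimensional _).measurable
    have h1 := integral_map (μ := volume) hm.aemeasurable hgc.aestronglyMeasurable
    rw [Real.map_matrix_volume_pi_eq_smul_volume_pi hBd, integral_smul_measure,
      ENNReal.toReal_ofReal (abs_nonneg _), abs_inv, smul_eq_mul,
      inv_mul_eq_iff_eq_mul₀ (abs_ne_zero.2 hBd)] at h1
    rw [h1]
    simp only [hg, toLin'_apply, hquad]
  have hnorm : ∀ z : Fin k → ℝ, ∏ i, |(B *ᵥ z) i| =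
      (∏ i, √(S i i)) * ∏ i, |∑ j, (B i j / √(S i i)) * z j| := by
    intro z
    rw [← Finset.prod_mul_distrib]
    refine Finset.prod_congr rfl fun i _ => ?_
    have hi : (B *ᵥ z) i = √(S i i) * ∑ j, (B i j / √(S i i)) * z j := by
      rw [Finset.mul_sum]
      change ∑ j, B i j * z j = _
      refine Finset.sum_congr rfl fun j _ => ?_
      have := (hσ i).ne'
      field_simp
    rw [hi, abs_mul, abs_of_pos (hσ i)]
  have hrow : ∀ i, ∑ j, (B i j / √(S i i)) ^ 2 = 1 := fun i => by
    simp_rw [div_pow]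
    rw [← Finset.sum_div, ← hdiag, Real.sq_sqrt (hS.diag_pos).le, div_self (hS.diag_pos).ne']
  obtain ⟨hl, hu⟩ := h _ hrow
  rw [hchange, hdet, Real.sqrt_sq_eq_abs]
  simp_rw [hnorm, mul_assoc]
  rw [integral_const_mul]
  have hP : 0 ≤ |B.det| * ∏ i, √(S i i) := by positivity
  constructor
  · calc _ = (|B.det| * ∏ i, √(S i i)) * c := by ring
      _ ≤ _ := (mul_le_mul_of_nonneg_left hl hP).trans_eq (by ring)
  · rw [← mul_assoc]
    exact (mul_le_mul_of_nonneg_left hu hP).trans_eq (by ring)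

lemma prod_filter_lt_eq_prod_prod_Iio {k : ℕ} {f : Fin k → Fin k → ℝ}
    (hf : ∀ i j, f i j = f j i) :
    ∏ p ∈ Finset.univ.filter (fun p : Fin k × Fin k => p.1 < p.2), f p.1 p.2 =
      ∏ i, ∏ j ∈ Finset.Iio i, f i j := by
  rw [Finset.prod_sigma']
  refine Finset.prod_nbij' (fun p => ⟨p.2, p.1⟩) (fun q => (q.2, q.1)) ?_ ?_ ?_ ?_ ?_ <;>
    simp [hf]

lemma prod_prod_compl_eq_sq {k : ℕ} {f : Fin k → Fin k → ℝ} (hf : ∀ i j, f i j = f j i) :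
    ∏ i, ∏ j ∈ {i}ᶜ, f i j = (∏ i, ∏ j ∈ Finset.Iio i, f i j) ^ 2 := by
  rw [← Finset.prod_prod_Ioi_mul_eq_prod_prod_off_diag fun i j => f j i]
  simp_rw [Finset.prod_mul_distrib]
  rw [sq]
  congr 1
  · rw [Finset.prod_comm' (t' := Finset.univ) (s' := Finset.Iio) (by simp)]
    simp_rw [hf]
  · rw [Finset.prod_comm' (t' := Finset.univ) (s' := Finset.Iio) (by simp)]

/-- The Kac–Rice density is determined by the value covariance and the conditional covariance of
the derivatives. -/
lemma exists_weylRho_bounds_of_covariance (k : ℕ) : ∃ c C : ℝ, 0 < c ∧ 0 < C ∧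
    ∀ (x : Fin k → ℝ) (S : Matrix (Fin k) (Fin k) ℝ), S.PosDef →
      0 < (weylGram x fun _ => 0).det →
      (weylGamma x).det = (weylGram x fun _ => 0).det * S.det →
      (∀ η : Fin k → ℝ, ∑ p, (weylGamma x)⁻¹.mulVec (weylEta η) p * weylEta η p =
        dotProduct η (S⁻¹.mulVec η)) →
      c * ((∏ i, √(S i i)) / √(weylGram x fun _ => 0).det) ≤ weylRho k x ∧
      weylRho k x ≤ C * ((∏ i, √(S i i)) / √(weylGram x fun _ => 0).det) := by
  obtain ⟨c, C, hc, hC, h⟩ := exists_integral_prod_abs_mul_exp_bounds k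
  refine ⟨((2 * Real.pi) ^ k)⁻¹ * c, ((2 * Real.pi) ^ k)⁻¹ * C, by positivity, by positivity,
    fun x S hS hA hdet hquad => ?_⟩
  obtain ⟨hl, hu⟩ := h S hS
  have hSd := hS.det_pos
  have hS0 := (Real.sqrt_pos.2 hSd).ne'
  have hA0 := (Real.sqrt_pos.2 hA).ne'
  unfold weylRho
  simp_rw [hquad]
  rw [hdet, abs_of_pos (mul_pos hA hSd), Real.sqrt_mul hA.le]
  have hP : 0 ≤ ((2 * Real.pi) ^ k)⁻¹ * (√(weylGram x fun _ => 0).det * √S.det)⁻¹ := by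
    positivity
  constructor
  · refine le_of_eq_of_le ?_ (mul_le_mul_of_nonneg_left hl hP)
    field_simp
  · refine (mul_le_mul_of_nonneg_left hu hP).trans_eq ?_
    field_simp

lemma sqrt_prod_exp_sq_mul_sq {k : ℕ} (x g : Fin k → ℝ) (hg : ∀ i, 0 ≤ g i) :
    √(∏ i, (Real.exp (x i ^ 2) * g i ^ 2)) = (∏ i, Real.exp (x i ^ 2 / 2)) * ∏ i, g i := by
  rw [← Finset.prod_mul_distrib]
  refine (Real.sqrt_eq_iff_mul_self_eq (Finset.prod_nonneg fun i _ => by positivity)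
    (Finset.prod_nonneg fun i _ => mul_nonneg (Real.exp_nonneg _) (hg i))).2 ?_
  rw [← Finset.prod_mul_distrib]
  refine Finset.prod_congr rfl fun i _ => ?_
  have : Real.exp (x i ^ 2) = Real.exp (x i ^ 2 / 2) * Real.exp (x i ^ 2 / 2) := by
    rw [← Real.exp_add, add_halves]
  rw [this]
  ring

/-- **Global estimates for the correlation functions of real zeros of the Weyl series.**
Let `ℓ(t) = min(1, |t|)`. For every `k ≥ 1` there is `C_k > 0` (depending only on `k`)
such that for all distinct reals `x_1, …, x_k`,
`(1/C_k) ∏_{i<j} ℓ(|x_i − x_j|) ≤ ρ_k(x_1,…,x_k) ≤ C_k ∏_{i<j} ℓ(|x_i − x_j|)`. -/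
theorem weyl_correlation_global_estimate :
    ∀ k : ℕ, 1 ≤ k → ∃ Ck : ℝ, 0 < Ck ∧
      ∀ x : Fin k → ℝ, Function.Injective x →
        (1 / Ck) * (∏ p ∈ Finset.univ.filter (fun p : Fin k × Fin k => p.1 < p.2),
            min 1 |x p.1 - x p.2|) ≤ weylRho k x ∧
        weylRho k x ≤ Ck * ∏ p ∈ Finset.univ.filter (fun p : Fin k × Fin k => p.1 < p.2),
            min 1 |x p.1 - x p.2| := by
  intro k _
  obtain ⟨a, A, ha, hA, hdet⟩ := exists_det_weylGram_bounds k
  obtain ⟨b, B, hb, hB, hcond⟩ := exists_conditional_covariance_bounds k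
  obtain ⟨c, C, hc, hC, hrho⟩ := exists_weylRho_bounds_of_covariance k
  refine ⟨max (c * (√(b ^ k) / √A))⁻¹ (C * (√(B ^ k) / √a)), by positivity, fun x hx => ?_⟩
  set l : Fin k → Fin k → ℝ := fun i j => min 1 |x i - x j| with hldef
  have hl : ∀ i j, l i j = l j i := fun i j => by simp only [hldef, abs_sub_comm]
  have hl0 : ∀ i j, 0 ≤ l i j := fun i j => by positivity
  have hlpos : ∀ i j, j ≠ i → 0 < l i j := fun i j hij =>
    lt_min one_pos (abs_pos.2 (sub_ne_zero.2 fun h => hij (hx h).symm))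
  obtain ⟨S, hS, hSdet, hSquad, hSdiag⟩ := hcond x hx
  have hG := (weylGram_value_posDef hx).det_pos
  obtain ⟨hdl, hdu⟩ := hdet x hx
  obtain ⟨hrl, hru⟩ := hrho x S hS hG hSdet hSquad
  rw [prod_filter_lt_eq_prod_prod_Iio hl]
  set W := ∏ i, ∏ j ∈ Finset.Iio i, l i j with hW
  set E := ∏ i, Real.exp (x i ^ 2 / 2) with hE
  have hWpos : 0 < W := Finset.prod_pos fun i _ => Finset.prod_pos fun j hj =>
    hlpos i j (Finset.mem_Iio.1 hj).ne
  have hEpos : 0 < E := Finset.prod_pos fun i _ => Real.exp_pos _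
  have hsqA : √(∏ i, (Real.exp (x i ^ 2) * (∏ j ∈ Finset.Iio i, l i j) ^ 2)) = E * W :=
    sqrt_prod_exp_sq_mul_sq x _ fun i => Finset.prod_nonneg fun j _ => hl0 i j
  have hsqS : √(∏ i, (Real.exp (x i ^ 2) * (∏ j ∈ {i}ᶜ, l i j) ^ 2)) = E * W ^ 2 := by
    rw [sqrt_prod_exp_sq_mul_sq x _ fun i => Finset.prod_nonneg fun j _ => hl0 i j,
      prod_prod_compl_eq_sq hl]
  have hGl : √a * (E * W) ≤ √(weylGram x fun _ => 0).det := by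
    rw [← hsqA, ← Real.sqrt_mul ha.le]
    exact Real.sqrt_le_sqrt hdl
  have hGu : √(weylGram x fun _ => 0).det ≤ √A * (E * W) := by
    rw [← hsqA, ← Real.sqrt_mul hA.le]
    exact Real.sqrt_le_sqrt hdu
  have hSl : √(b ^ k) * (E * W ^ 2) ≤ ∏ i, √(S i i) := by
    rw [← hsqS, ← Real.sqrt_mul (by positivity), ← Real.sqrt_prod _ fun i _ => hS.diag_pos.le]
    refine Real.sqrt_le_sqrt ?_
    rw [← Fin.prod_const, ← Finset.prod_mul_distrib]
    exact Finset.prod_le_prod (fun i _ => by positivity) fun i _ => (hSdiag i).1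
  have hSu : ∏ i, √(S i i) ≤ √(B ^ k) * (E * W ^ 2) := by
    rw [← hsqS, ← Real.sqrt_mul (by positivity), ← Real.sqrt_prod _ fun i _ => hS.diag_pos.le]
    refine Real.sqrt_le_sqrt ?_
    rw [← Fin.prod_const, ← Finset.prod_mul_distrib]
    exact Finset.prod_le_prod (fun i _ => hS.diag_pos.le) fun i _ => (hSdiag i).2
  constructor
  · calc 1 / max (c * (√(b ^ k) / √A))⁻¹ (C * (√(B ^ k) / √a)) * W
        ≤ 1 / (c * (√(b ^ k) / √A))⁻¹ * W := by gcongr; exact le_max_left _ _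
      _ = c * ((√(b ^ k) * (E * W ^ 2)) / (√A * (E * W))) := by field_simp
      _ ≤ c * ((∏ i, √(S i i)) / √(weylGram x fun _ => 0).det) := by gcongr
      _ ≤ weylRho k x := hrl
  · calc weylRho k x ≤ C * ((∏ i, √(S i i)) / √(weylGram x fun _ => 0).det) := hru
      _ ≤ C * ((√(B ^ k) * (E * W ^ 2)) / (√a * (E * W))) := by gcongr
      _ = C * (√(B ^ k) / √a) * W := by field_simp
      _ ≤ max (c * (√(b ^ k) / √A))⁻¹ (C * (√(B ^ k) / √a)) * W := by
        gcongr; exact le_max_right _ _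

end
end
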